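/- arXiv:math/0609341 — 2 statements merged into one kernel-verified Lean document; each statement's English description precedes it below -/
import Mathlib

section
/- Let B be the closed ball of radius R > 0 centered at the origin in ℝ³, let λ > 0, and let x, y be interior points of B. Define j₀(t) = sin t / t and n₀(t) = -cos t / t, and set I(x, y) = ∫_{|z|=R} n₀(λ|y - z|) ∂_{n_z} j₀(λ|z - x|) dσ(z), where ∂_{n_z} φ(z) = (z/R)·∇_z φ(z) is the outward normal derivative on the sphere and σ is its surface measure. Then I(x, y) = I(y, x). -/
open MeasureTheory Real

/-- The spherical Bessel function of order zero, `j₀(t) = sin t / t` (with `j₀(0) = 1`). -/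
noncomputable def j0 (t : ℝ) : ℝ := if t = 0 then 1 else Real.sin t / t

/-- The spherical Neumann function of order zero, `n₀(t) = -cos t / t`. -/
noncomputable def n0 (t : ℝ) : ℝ := -Real.cos t / t

abbrev E3 := EuclideanSpace ℝ (Fin 3)

/-- Surface measure on the sphere of radius `R`. -/
noncomputable def sph (R : ℝ) : Measure E3 := (μH[2] : Measure E3).restrict (Metric.sphere 0 R)

lemma E3_norm_sq (z : E3) : ‖z‖ ^ 2 = z 0 ^ 2 + z 1 ^ 2 + z 2 ^ 2 := by
  rw [EuclideanSpace.norm_sq_eq, Fin.sum_univ_three]; simp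

lemma E3_inner (x z : E3) : inner ℝ x z = x 0 * z 0 + x 1 * z 1 + x 2 * z 2 := by
  rw [PiLp.inner_apply, Fin.sum_univ_three]; simp [mul_comm]

lemma sphere_finite (R : ℝ) (hR : 0 < R) : (μH[2] : Measure E3) (Metric.sphere 0 R) < ⊤ := by
  let g : (Fin 2 → ℝ) → E3 := fun v =>
    !₂[R * cos (v 0) * cos (v 1), R * cos (v 0) * sin (v 1), R * sin (v 0)]
  let K : Set (Fin 2 → ℝ) := Set.Icc (fun _ => -π) (fun _ => π)
  have hK : IsCompact K := isCompact_Icc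
  have hg : ContDiff ℝ 1 g := by
    rw [contDiff_euclidean]
    intro i
    fin_cases i <;> simp [g] <;> fun_prop
  obtain ⟨C, hC⟩ := (hg.locallyLipschitz.locallyLipschitzOn (s := K)).exists_lipschitzOnWith_of_compact hK
  have h1 := hC.hausdorffMeasure_image_le (d := 2) (by norm_num)
  have h2 : (μH[2] : Measure (Fin 2 → ℝ)) = volume := by
    rw [← hausdorffMeasure_pi_real]; simp
  have hsub : Metric.sphere (0 : E3) R ⊆ g '' K := by
    intro z hz
    have hz' : ‖z‖ = R := by simpa using hz
    have hn := E3_norm_sq z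
    rw [hz'] at hn
    let w : ℂ := ⟨z 0, z 1⟩
    have hw : ‖w‖ ^ 2 = z 0 ^ 2 + z 1 ^ 2 := by
      rw [Complex.sq_norm, Complex.normSq_apply]; simp [w]; ring
    have hw1 : ‖w‖ * cos w.arg = z 0 := by rw [Complex.norm_mul_cos_arg]
    have hw2 : ‖w‖ * sin w.arg = z 1 := by rw [Complex.norm_mul_sin_arg]
    let u : ℂ := ⟨‖w‖, z 2⟩
    have hu : ‖u‖ = R := by
      have : ‖u‖ ^ 2 = R ^ 2 := by
        rw [Complex.sq_norm, Complex.normSq_apply]; simp [u]; nlinarith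
      exact (pow_left_inj₀ (norm_nonneg _) hR.le two_ne_zero).1 this
    have hu1 : R * cos u.arg = ‖w‖ := by rw [← hu, Complex.norm_mul_cos_arg]
    have hu2 : R * sin u.arg = z 2 := by rw [← hu, Complex.norm_mul_sin_arg]
    refine ⟨![u.arg, w.arg], ?_, ?_⟩
    · constructor <;> intro i <;> fin_cases i <;>
        simp [Complex.arg_le_pi, (Complex.neg_pi_lt_arg _).le]
    · ext i
      fin_cases i <;> simp [g, hu1, hu2, hw1, hw2]
  refine (measure_mono hsub).trans_lt (h1.trans_lt ?_)
  rw [h2]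
  refine ENNReal.mul_lt_top (by simp) hK.measure_lt_top

lemma sph_ae (R : ℝ) : ∀ᵐ z ∂(sph R), z ∈ Metric.sphere (0 : E3) R :=
  ae_restrict_mem Metric.isClosed_sphere.measurableSet

lemma sph_finite (R : ℝ) (hR : 0 < R) : IsFiniteMeasure (sph R) :=
  ⟨by rw [sph, Measure.restrict_apply_univ]; exact sphere_finite R hR⟩

lemma sph_comp (R : ℝ) (e : E3 ≃ₗᵢ[ℝ] E3) (f : E3 → ℝ) :
    ∫ z, f (e z) ∂(sph R) = ∫ z, f z ∂(sph R) := by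
  have h := (e.toIsometryEquiv.measurePreserving_hausdorffMeasure 2).setIntegral_preimage_emb
    e.toHomeomorph.measurableEmbedding f (Metric.sphere 0 R)
  have h2 : e.toIsometryEquiv ⁻¹' (Metric.sphere (0 : E3) R) = Metric.sphere 0 R := by
    ext z; simp
  rw [h2] at h
  exact h

lemma sph_int_cont {R : ℝ} (hR : 0 < R) {f : E3 → ℝ} (hf : ContinuousOn f (Metric.sphere 0 R)) :
    Integrable f (sph R) := by
  have := sph_finite R hR
  exact hf.integrableOn_of_subset_isCompact (isCompact_sphere _ _)
    Metric.isClosed_sphere.measurableSet subset_rfl (sphere_finite R hR).ne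

lemma sph_deriv {R : ℝ} (hR : 0 < R) {a b t0 : ℝ} (ht : t0 ∈ Set.Ioo a b) {F F' : ℝ → E3 → ℝ}
    (hF : ∀ t ∈ Set.Ioo a b, ContinuousOn (F t) (Metric.sphere 0 R))
    (hF' : ContinuousOn (fun p : ℝ × E3 => F' p.1 p.2) (Set.Ioo a b ×ˢ Metric.sphere 0 R))
    (hd : ∀ z ∈ Metric.sphere (0 : E3) R, ∀ t ∈ Set.Ioo a b, HasDerivAt (F · z) (F' t z) t) :
    HasDerivAt (fun t => ∫ z, F t z ∂(sph R)) (∫ z, F' t0 z ∂(sph R)) t0 := by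
  have := sph_finite R hR
  obtain ⟨a', ha'⟩ := exists_between ht.1
  obtain ⟨b', hb'⟩ := exists_between ht.2
  have hsub : Set.Icc a' b' ⊆ Set.Ioo a b := Set.Icc_subset_Ioo ha'.1 hb'.2
  obtain ⟨C, hC⟩ := (isCompact_Icc.prod (isCompact_sphere (0 : E3) R)).exists_bound_of_continuousOn
    (hF'.mono (Set.prod_mono hsub subset_rfl))
  have hslice : ContinuousOn (F' t0) (Metric.sphere 0 R) :=
    hF'.comp (f := fun z : E3 => (t0, z)) (by fun_prop) (fun z hz => ⟨ht, hz⟩)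
  refine (hasDerivAt_integral_of_dominated_loc_of_deriv_le (s := Set.Icc a' b')
    (bound := fun _ => C) (Icc_mem_nhds ha'.2 hb'.1) ?_ ?_ ?_ ?_ (integrable_const _) ?_).2
  · filter_upwards [Ioo_mem_nhds ht.1 ht.2] with t ht
    exact (sph_int_cont hR (hF t ht)).aestronglyMeasurable
  · exact sph_int_cont hR (hF t0 ht)
  · exact (sph_int_cont hR hslice).aestronglyMeasurable
  · filter_upwards [sph_ae R] with z hz t ht
    exact hC (t, z) ⟨ht, hz⟩
  · filter_upwards [sph_ae R] with z hz t ht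
    exact hd z hz t (hsub ht)

noncomputable def rotFun (i j : Fin 3) (t : ℝ) (z : E3) : E3 :=
  WithLp.toLp 2 fun m => if m = i then cos t * z i - sin t * z j else
    if m = j then sin t * z i + cos t * z j else z m

noncomputable def rotE (i j : Fin 3) (hij : i ≠ j) (t : ℝ) : E3 ≃ₗᵢ[ℝ] E3 where
  toFun := rotFun i j t
  invFun := rotFun i j (-t)
  map_add' x y := by
    ext m; simp only [rotFun, PiLp.add_apply]; split_ifs <;> ring
  map_smul' c x := by
    ext m; simp only [rotFun, PiLp.smul_apply, smul_eq_mul, RingHom.id_apply]; split_ifs <;> ring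
  left_inv x := by
    have := sin_sq_add_cos_sq t
    ext m; simp only [rotFun, cos_neg, sin_neg, if_true, if_neg hij.symm]
    split_ifs with h1 h2
    · subst h1; linear_combination (x m) * this
    · subst h2; linear_combination (x m) * this
    · rfl
  right_inv x := by
    have := sin_sq_add_cos_sq t
    ext m; simp only [rotFun, cos_neg, sin_neg, if_true, if_neg hij.symm]
    split_ifs with h1 h2
    · subst h1; linear_combination (x m) * this
    · subst h2; linear_combination (x m) * this
    · rfl
  norm_map' x := by
    have := sin_sq_add_cos_sq t
    have h : ‖rotFun i j t x‖ ^ 2 = ‖x‖ ^ 2 := by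
      rw [E3_norm_sq, E3_norm_sq]
      revert hij
      fin_cases i <;> fin_cases j <;> simp [rotFun] <;> 
      first
      | linear_combination (x 0 ^ 2 + x 1 ^ 2) * this
      | linear_combination (x 0 ^ 2 + x 2 ^ 2) * this
      | linear_combination (x 1 ^ 2 + x 2 ^ 2) * this
    exact (pow_left_inj₀ (norm_nonneg _) (norm_nonneg _) two_ne_zero).1 h

lemma rot_add (i j : Fin 3) (hij : i ≠ j) (s t : ℝ) (z : E3) :
    rotFun i j (t + s) z = rotFun i j s (rotFun i j t z) := by
  ext m
  simp only [rotFun, cos_add, sin_add, if_true, if_neg hij.symm]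
  split_ifs <;> ring

/-- Divergence theorem for rotation fields. -/
lemma sph_rot {R : ℝ} (hR : 0 < R) (i j : Fin 3) (hij : i ≠ j) {φ ψ : E3 → ℝ}
    (hφ : ContinuousOn φ (Metric.sphere 0 R)) (hψ : ContinuousOn ψ (Metric.sphere 0 R))
    (hd : ∀ z ∈ Metric.sphere (0 : E3) R, HasDerivAt (fun t => φ (rotFun i j t z)) (ψ z) 0) :
    ∫ z, ψ z ∂(sph R) = 0 := by
  have hm : ∀ t, ∀ z ∈ Metric.sphere (0 : E3) R, rotFun i j t z ∈ Metric.sphere (0 : E3) R := by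
    intro t z hz
    have := (rotE i j hij t).norm_map z
    have h2 : rotE i j hij t z = rotFun i j t z := rfl
    rw [h2] at this
    simpa [this] using hz
  have hc : Continuous fun p : ℝ × E3 => rotFun i j p.1 p.2 := by
    unfold rotFun
    refine (PiLp.continuous_toLp 2 _).comp (continuous_pi fun m => ?_)
    split_ifs <;> fun_prop
  have h0 : ∀ z, rotFun i j 0 z = z := by
    intro z; ext m; simp only [rotFun, cos_zero, sin_zero]; split_ifs <;> simp_all
  have h := sph_deriv hR (a := -1) (b := 1) (t0 := 0) (by simp)
    (F := fun t z => φ (rotFun i j t z)) (F' := fun t z => ψ (rotFun i j t z))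
    (fun t _ => hφ.comp (hc.comp (by fun_prop : Continuous fun z : E3 => (t, z))).continuousOn
      (fun z hz => hm t z hz))
    (hψ.comp hc.continuousOn (fun p hp => hm _ _ hp.2))
    (by
      intro z hz t _
      have h1 := hd _ (hm t z hz)
      have h2 : HasDerivAt (fun s => φ (rotFun i j (s - t) (rotFun i j t z)))
          (ψ (rotFun i j t z)) t := by
        have h3 := HasDerivAt.comp_sub_const t t (f := fun s => φ (rotFun i j s (rotFun i j t z)))
          (by rw [sub_self]; exact h1)
        exact h3
      convert h2 using 3 with s
      rw [← rot_add i j hij]; congr 1; ring)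
  have h2 : (fun t => ∫ z, φ (rotFun i j t z) ∂(sph R)) = fun _ => ∫ z, φ z ∂(sph R) := by
    funext t
    exact sph_comp R (rotE i j hij t) φ
  rw [h2] at h
  have := h.unique (hasDerivAt_const _ _)
  simpa [h0] using this

lemma inner_mem_Icc {R : ℝ} {x z : E3} (hx : ‖x‖ = 1) (hz : z ∈ Metric.sphere (0 : E3) R) :
    inner ℝ x z ∈ Set.Icc (-R) R := by
  have hz' : ‖z‖ = R := by simpa using hz
  have := abs_real_inner_le_norm x z
  rw [hx, hz', one_mul] at this
  exact abs_le.1 this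

lemma rot_coord_deriv (i j : Fin 3) (hij : i ≠ j) (x z : E3) :
    HasDerivAt (fun t => inner ℝ x (rotFun i j t z)) (x j * z i - x i * z j) 0 ∧
    HasDerivAt (fun t => x j * rotFun i j t z i - x i * rotFun i j t z j)
      (-(x j * z j) - x i * z i) 0 := by
  have hs : HasDerivAt sin 1 0 := by simpa using hasDerivAt_sin 0
  have hc : HasDerivAt cos 0 0 := by simpa using hasDerivAt_cos 0
  have hi : HasDerivAt (fun t => cos t * z i - sin t * z j) (- z j) 0 := by
    exact ((hc.mul_const (z i)).sub (hs.mul_const (z j))).congr_deriv (by ring)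
  have hj : HasDerivAt (fun t => sin t * z i + cos t * z j) (z i) 0 := by
    exact ((hs.mul_const (z i)).add (hc.mul_const (z j))).congr_deriv (by ring)
  constructor
  · have h : ∀ t, inner ℝ x (rotFun i j t z) = inner ℝ x z + x i * ((cos t * z i - sin t * z j) - z i)
        + x j * ((sin t * z i + cos t * z j) - z j) := by
      intro t
      rw [E3_inner, E3_inner]
      revert hij
      fin_cases i <;> fin_cases j <;> simp [rotFun] <;> ring
    simp_rw [h]
    have := (((hi.sub_const (z i)).const_mul (x i)).const_add (inner ℝ x z)).add
      ((hj.sub_const (z j)).const_mul (x j))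
    exact this.congr_deriv (by ring)
  · simp only [rotFun, if_true, if_neg hij.symm]
    exact ((hi.const_mul (x j)).sub (hj.const_mul (x i))).congr_deriv (by ring)

lemma selfadj_half {R : ℝ} (hR : 0 < R) {x y : E3} (hx : ‖x‖ = 1) (hy : ‖y‖ = 1)
    {f f1 g g1 g2 : ℝ → ℝ}
    (hf : ∀ c ∈ Set.Icc (-R) R, HasDerivAt f (f1 c) c) (hf1 : ContinuousOn f1 (Set.Icc (-R) R))
    (hg1 : ∀ c ∈ Set.Icc (-R) R, HasDerivAt g1 (g2 c) c) (hg2 : ContinuousOn g2 (Set.Icc (-R) R)) :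
    ∫ z, (f (inner ℝ y z) * ((R ^ 2 - inner ℝ x z ^ 2) * g2 (inner ℝ x z)
        - 2 * inner ℝ x z * g1 (inner ℝ x z))
      + f1 (inner ℝ y z) * g1 (inner ℝ x z) * (R ^ 2 * inner ℝ x y - inner ℝ x z * inner ℝ y z))
      ∂(sph R) = 0 := by
  have cf : ContinuousOn f (Set.Icc (-R) R) := fun c hc => (hf c hc).continuousAt.continuousWithinAt
  have cg1 : ContinuousOn g1 (Set.Icc (-R) R) :=
    fun c hc => (hg1 c hc).continuousAt.continuousWithinAt
  have mx : Set.MapsTo (fun z : E3 => inner ℝ x z) (Metric.sphere 0 R) (Set.Icc (-R) R) :=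
    fun z hz => inner_mem_Icc hx hz
  have my : Set.MapsTo (fun z : E3 => inner ℝ y z) (Metric.sphere 0 R) (Set.Icc (-R) R) :=
    fun z hz => inner_mem_Icc hy hz
  have ix : ContinuousOn (fun z : E3 => inner ℝ x z) (Metric.sphere 0 R) := by fun_prop
  have iy : ContinuousOn (fun z : E3 => inner ℝ y z) (Metric.sphere 0 R) := by fun_prop
  have kf := cf.comp iy my
  have kf1 := hf1.comp iy my
  have kg1 := cg1.comp ix mx
  have kg2 := hg2.comp ix mx
  simp only [Function.comp_def] at kf kf1 kg1 kg2
  let ψ : Fin 3 → Fin 3 → E3 → ℝ := fun i j z =>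
    f1 (inner ℝ y z) * (y j * z i - y i * z j) * g1 (inner ℝ x z) * (x j * z i - x i * z j)
    + f (inner ℝ y z) * (g2 (inner ℝ x z) * (x j * z i - x i * z j) ^ 2)
    + f (inner ℝ y z) * g1 (inner ℝ x z) * (-(x j * z j) - x i * z i)
  have cψ : ∀ i j, ContinuousOn (ψ i j) (Metric.sphere 0 R) := by
    intro i j
    simp only [ψ]
    fun_prop
  have key : ∀ i j, i ≠ j → ∫ z, ψ i j z ∂(sph R) = 0 := by
    intro i j hij
    refine sph_rot hR i j hij
      (φ := fun z => f (inner ℝ y z) * g1 (inner ℝ x z) * (x j * z i - x i * z j)) ?_ (cψ i j) ?_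
    · fun_prop
    · intro z hz
      obtain ⟨hx1, hx2⟩ := rot_coord_deriv i j hij x z
      obtain ⟨hy1, -⟩ := rot_coord_deriv i j hij y z
      have h0 : rotFun i j 0 z = z := by
        ext m; simp only [rotFun, cos_zero, sin_zero]; split_ifs <;> simp_all
      have hfz := (hf _ (my hz))
      have hgz := (hg1 _ (mx hz))
      have a1 : HasDerivAt (fun t => f (inner ℝ y (rotFun i j t z)))
          (f1 (inner ℝ y z) * (y j * z i - y i * z j)) 0 := by
        refine HasDerivAt.comp (h₂ := f) 0 ?_ hy1
        rw [h0]; exact hfz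
      have a2 : HasDerivAt (fun t => g1 (inner ℝ x (rotFun i j t z)))
          (g2 (inner ℝ x z) * (x j * z i - x i * z j)) 0 := by
        refine HasDerivAt.comp (h₂ := g1) 0 ?_ hx1
        rw [h0]; exact hgz
      refine ((a1.mul a2).mul hx2).congr_deriv ?_
      simp only [ψ, h0, Pi.mul_apply]
      ring
  have e : ∀ z ∈ Metric.sphere (0 : E3) R,
      (f (inner ℝ y z) * ((R ^ 2 - inner ℝ x z ^ 2) * g2 (inner ℝ x z)
        - 2 * inner ℝ x z * g1 (inner ℝ x z))
      + f1 (inner ℝ y z) * g1 (inner ℝ x z) * (R ^ 2 * inner ℝ x y - inner ℝ x z * inner ℝ y z))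
      = ψ 0 1 z + ψ 0 2 z + ψ 1 2 z := by
    intro z hz
    have hz' : ‖z‖ = R := by simpa using hz
    have hn := E3_norm_sq z
    have hxn := E3_norm_sq x
    rw [hz'] at hn
    rw [hx] at hxn
    simp only [ψ]
    generalize f (inner ℝ y z) = F
    generalize f1 (inner ℝ y z) = F1
    generalize g1 (inner ℝ x z) = G1
    generalize g2 (inner ℝ x z) = G2
    rw [E3_inner, E3_inner, E3_inner]
    have e1 : R ^ 2 - (x 0 * z 0 + x 1 * z 1 + x 2 * z 2) ^ 2 =
      (x 1 * z 0 - x 0 * z 1) ^ 2 + (x 2 * z 0 - x 0 * z 2) ^ 2 + (x 2 * z 1 - x 1 * z 2) ^ 2 := by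
      linear_combination hn + (z 0 ^ 2 + z 1 ^ 2 + z 2 ^ 2) * hxn
    rw [e1, hn]
    ring
  have i01 := sph_int_cont hR (cψ 0 1)
  have i02 := sph_int_cont hR (cψ 0 2)
  have i12 := sph_int_cont hR (cψ 1 2)
  rw [integral_congr_ae ((sph_ae R).mono e), integral_add (f := fun z => ψ 0 1 z + ψ 0 2 z) (i01.add i02) i12, integral_add i01 i02,
    key 0 1 (by decide), key 0 2 (by decide), key 1 2 (by decide)]
  simp

lemma selfadj {R : ℝ} (hR : 0 < R) {x y : E3} (hx : ‖x‖ = 1) (hy : ‖y‖ = 1)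
    {f f1 f2 g g1 g2 : ℝ → ℝ}
    (hf : ∀ c ∈ Set.Icc (-R) R, HasDerivAt f (f1 c) c)
    (hf1 : ∀ c ∈ Set.Icc (-R) R, HasDerivAt f1 (f2 c) c) (hf2 : ContinuousOn f2 (Set.Icc (-R) R))
    (hg : ∀ c ∈ Set.Icc (-R) R, HasDerivAt g (g1 c) c)
    (hg1 : ∀ c ∈ Set.Icc (-R) R, HasDerivAt g1 (g2 c) c) (hg2 : ContinuousOn g2 (Set.Icc (-R) R)) :
    ∫ z, (f (inner ℝ y z) * ((R ^ 2 - inner ℝ x z ^ 2) * g2 (inner ℝ x z)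
        - 2 * inner ℝ x z * g1 (inner ℝ x z))
      - ((R ^ 2 - inner ℝ y z ^ 2) * f2 (inner ℝ y z)
        - 2 * inner ℝ y z * f1 (inner ℝ y z)) * g (inner ℝ x z)) ∂(sph R) = 0 := by
  have cf : ContinuousOn f (Set.Icc (-R) R) := fun c hc => (hf c hc).continuousAt.continuousWithinAt
  have cf1 : ContinuousOn f1 (Set.Icc (-R) R) :=
    fun c hc => (hf1 c hc).continuousAt.continuousWithinAt
  have cg : ContinuousOn g (Set.Icc (-R) R) := fun c hc => (hg c hc).continuousAt.continuousWithinAt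
  have cg1 : ContinuousOn g1 (Set.Icc (-R) R) :=
    fun c hc => (hg1 c hc).continuousAt.continuousWithinAt
  have mx : Set.MapsTo (fun z : E3 => inner ℝ x z) (Metric.sphere 0 R) (Set.Icc (-R) R) :=
    fun z hz => inner_mem_Icc hx hz
  have my : Set.MapsTo (fun z : E3 => inner ℝ y z) (Metric.sphere 0 R) (Set.Icc (-R) R) :=
    fun z hz => inner_mem_Icc hy hz
  have ix : ContinuousOn (fun z : E3 => inner ℝ x z) (Metric.sphere 0 R) := by fun_prop
  have iy : ContinuousOn (fun z : E3 => inner ℝ y z) (Metric.sphere 0 R) := by fun_prop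
  have kf := cf.comp iy my
  have kf1 := cf1.comp iy my
  have kf2 := hf2.comp iy my
  have kg := cg.comp ix mx
  have kg1 := cg1.comp ix mx
  have kg2 := hg2.comp ix mx
  simp only [Function.comp_def] at kf kf1 kf2 kg kg1 kg2
  have h1 := selfadj_half (g := g) hR hx hy hf cf1 hg1 hg2
  have h2 := selfadj_half (g := f) hR hy hx hg cg1 hf1 hf2
  rw [← sub_self (0 : ℝ)]
  nth_rewrite 1 [← h1]
  rw [← h2, ← integral_sub (sph_int_cont hR (by fun_prop)) (sph_int_cont hR (by fun_prop))]
  congr 1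
  funext z
  rw [real_inner_comm y x]
  ring

/-- Goursat uniqueness. -/
lemma goursat {T H k : ℝ} (hH : 0 ≤ H) (hk : 0 ≤ k)
    {w w1 w2 : ℝ → ℝ → ℝ}
    (h1 : ∀ τ ∈ Set.Icc 0 T, ∀ h ∈ Set.Icc 0 H, HasDerivAt (fun t => w t h) (w1 τ h) τ)
    (h2 : ∀ τ ∈ Set.Icc 0 T, ∀ h ∈ Set.Icc 0 H, HasDerivAt (fun s => w1 τ s) (w2 τ h) h)
    (hb : ∀ τ ∈ Set.Icc 0 T, ∀ h ∈ Set.Icc 0 H, |w2 τ h| ≤ k * |w τ h|)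
    (h0 : ∀ h ∈ Set.Icc 0 H, w 0 h = 0) (h0' : ∀ τ ∈ Set.Icc 0 T, w1 τ 0 = 0)
    (C : ℝ) (hC : ∀ τ ∈ Set.Icc 0 T, ∀ h ∈ Set.Icc 0 H, |w τ h| ≤ C) :
    ∀ τ ∈ Set.Icc 0 T, ∀ h ∈ Set.Icc 0 H, w τ h = 0 := by
  have step : ∀ n : ℕ, ∀ τ ∈ Set.Icc 0 T, ∀ h ∈ Set.Icc 0 H,
      |w τ h| ≤ C * ((k * H * τ) ^ n / n.factorial) := by
    intro n
    induction n with
    | zero => simpa using hC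
    | succ n ih =>
      intro τ hτ h hh
      have hC0 : 0 ≤ C := (abs_nonneg _).trans (hC τ hτ h hh)
      have d1 : ∀ t ∈ Set.Icc 0 T, |w1 t h| ≤ k * H * (C * ((k * H * t) ^ n / n.factorial)) := by
        intro t ht
        have hpos : 0 ≤ C * ((k * H * t) ^ n / n.factorial) := by
          have := ht.1
          positivity
        have := norm_image_sub_le_of_norm_deriv_le_segment' (f := fun s => w1 t s)
          (f' := fun s => w2 t s) (a := 0) (b := H)
          (C := k * (C * ((k * H * t) ^ n / n.factorial)))
          (fun s hs => (h2 t ht s hs).hasDerivWithinAt)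
          (fun s hs => (hb t ht s (Set.Ico_subset_Icc_self hs)).trans
            (mul_le_mul_of_nonneg_left (ih t ht s (Set.Ico_subset_Icc_self hs)) hk)) h hh
        rw [h0' t ht, sub_zero, sub_zero, Real.norm_eq_abs] at this
        refine this.trans ?_
        have := mul_le_mul_of_nonneg_left hh.2 (mul_nonneg hk hpos)
        linarith
      have := image_norm_le_of_norm_deriv_right_le_deriv_boundary (f := fun t => w t h)
        (f' := fun t => w1 t h) (a := 0) (b := T)
        (B := fun t => C * ((k * H * t) ^ (n + 1) / (n + 1).factorial))
        (B' := fun t => k * H * (C * ((k * H * t) ^ n / n.factorial)))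
        (fun t ht => (h1 t ht h hh).continuousAt.continuousWithinAt)
        (fun t ht => (h1 t (Set.Ico_subset_Icc_self ht) h hh).hasDerivWithinAt)
        (by simp [h0 h hh]) ?_ (fun t ht => d1 t (Set.Ico_subset_Icc_self ht)) hτ
      · exact this
      · intro t
        have e := ((((hasDerivAt_id t).const_mul (k * H)).pow (n + 1)).div_const
          ((n + 1).factorial : ℝ)).const_mul C
        refine e.congr_deriv ?_
        rw [Nat.factorial_succ]
        have : (n.factorial : ℝ) ≠ 0 := by positivity
        have : (n : ℝ) + 1 ≠ 0 := by positivity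
        push_cast
        simp
        field_simp
  intro τ hτ h hh
  have lim := ((FloorSemiring.tendsto_pow_div_factorial_atTop (k * H * τ)).const_mul C)
  rw [mul_zero] at lim
  have := ge_of_tendsto' lim (fun n => step n τ hτ h hh)
  exact abs_nonpos_iff.1 this

/-- Zonal solutions of the Helmholtz equation, in radial and cosine variables. -/
structure Zon (R lam : ℝ) (A A1 A2 Ac Acc : ℝ → ℝ → ℝ) : Prop where
  dr : ∀ r ∈ Set.Ioo (-R) R, ∀ c ∈ Set.Icc (-R) R, HasDerivAt (fun r => A r c) (A1 r c) r
  drr : ∀ r ∈ Set.Ioo (-R) R, ∀ c ∈ Set.Icc (-R) R, HasDerivAt (fun r => A1 r c) (A2 r c) r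
  dc : ∀ r ∈ Set.Ioo (-R) R, ∀ c ∈ Set.Icc (-R) R, HasDerivAt (fun c => A r c) (Ac r c) c
  dcc : ∀ r ∈ Set.Ioo (-R) R, ∀ c ∈ Set.Icc (-R) R, HasDerivAt (fun c => Ac r c) (Acc r c) c
  cA : ContinuousOn (fun p : ℝ × ℝ => A p.1 p.2) (Set.Ioo (-R) R ×ˢ Set.Icc (-R) R)
  cA1 : ContinuousOn (fun p : ℝ × ℝ => A1 p.1 p.2) (Set.Ioo (-R) R ×ˢ Set.Icc (-R) R)
  cA2 : ContinuousOn (fun p : ℝ × ℝ => A2 p.1 p.2) (Set.Ioo (-R) R ×ˢ Set.Icc (-R) R)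
  cAcc : ContinuousOn (fun p : ℝ × ℝ => Acc p.1 p.2) (Set.Ioo (-R) R ×ˢ Set.Icc (-R) R)
  pde : ∀ r ∈ Set.Ioo (-R) R, ∀ c ∈ Set.Icc (-R) R,
    r ^ 2 * A2 r c + 2 * r * A1 r c + ((R ^ 2 - c ^ 2) * Acc r c - 2 * c * Ac r c)
      + lam ^ 2 * r ^ 2 * A r c = 0

lemma cont_helper {R : ℝ} {x : E3} (hx : ‖x‖ = 1) {X : ℝ → ℝ → ℝ}
    (hX : ContinuousOn (fun p : ℝ × ℝ => X p.1 p.2) (Set.Ioo (-R) R ×ˢ Set.Icc (-R) R))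
    {a b : ℝ} {ρ : ℝ → ℝ} (hρ : Continuous ρ) (hm : ∀ t ∈ Set.Ioo a b, ρ t ∈ Set.Ioo (-R) R) :
    ContinuousOn (fun p : ℝ × E3 => X (ρ p.1) (inner ℝ x p.2))
      (Set.Ioo a b ×ˢ Metric.sphere 0 R) :=
  hX.comp (f := fun p : ℝ × E3 => (ρ p.1, inner ℝ x p.2)) (by fun_prop)
    (fun p hp => ⟨hm _ hp.1, inner_mem_Icc hx hp.2⟩)

lemma slice_helper {R : ℝ} {a b : ℝ} {X : ℝ → E3 → ℝ}
    (h : ContinuousOn (fun p : ℝ × E3 => X p.1 p.2) (Set.Ioo a b ×ˢ Metric.sphere 0 R)) :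
    ∀ t ∈ Set.Ioo a b, ContinuousOn (X t) (Metric.sphere 0 R) := fun t ht =>
  h.comp (f := fun z : E3 => (t, z)) (by fun_prop) (fun z hz => ⟨ht, hz⟩)

lemma rad_mem {T0 H0 R τ h : ℝ} (hTR : T0 * exp H0 ≤ R) (hτ : τ ∈ Set.Ioo (-T0) T0)
    (hh : h ≤ H0) : τ * exp h ∈ Set.Ioo (-R) R := by
  have h1 : |τ| < T0 := abs_lt.2 hτ
  have h2 : exp h ≤ exp H0 := exp_le_exp.2 hh
  have : |τ * exp h| < R := by
    rw [abs_mul, abs_of_pos (exp_pos h)]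
    calc |τ| * exp h < T0 * exp h := by gcongr
      _ ≤ T0 * exp H0 := by
        have : 0 ≤ T0 := (abs_nonneg τ).trans h1.le
        gcongr
      _ ≤ R := hTR
  exact abs_lt.1 this

section
variable {R lam : ℝ} {A A1 A2 Ac Acc B B1 B2 Bc Bcc : ℝ → ℝ → ℝ}

lemma W_deriv_tau (hR : 0 < R) (hA : Zon R lam A A1 A2 Ac Acc) (hB : Zon R lam B B1 B2 Bc Bcc)
    {x y : E3} (hx : ‖x‖ = 1) (hy : ‖y‖ = 1) {T0 H0 τ h : ℝ} (hTR : T0 * exp H0 ≤ R)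
    (hτ : τ ∈ Set.Ioo (-T0) T0) (hh : h ∈ Set.Ioo (-H0) H0) :
    HasDerivAt (fun τ => ∫ z, τ * (A (τ * exp (-h)) (inner ℝ y z) * B (τ * exp h) (inner ℝ x z))
        ∂(sph R))
      (∫ z, (A (τ * exp (-h)) (inner ℝ y z) * B (τ * exp h) (inner ℝ x z)
        + (τ * exp (-h)) * (A1 (τ * exp (-h)) (inner ℝ y z) * B (τ * exp h) (inner ℝ x z))
        + (τ * exp h) * (A (τ * exp (-h)) (inner ℝ y z) * B1 (τ * exp h) (inner ℝ x z)))
        ∂(sph R)) τ := by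
  have m1 : ∀ t ∈ Set.Ioo (-T0) T0, t * exp h ∈ Set.Ioo (-R) R :=
    fun t ht => rad_mem hTR ht hh.2.le
  have m2 : ∀ t ∈ Set.Ioo (-T0) T0, t * exp (-h) ∈ Set.Ioo (-R) R :=
    fun t ht => rad_mem hTR ht (by linarith [hh.1])
  have k1 : Continuous fun t : ℝ => t * exp h := by fun_prop
  have k2 : Continuous fun t : ℝ => t * exp (-h) := by fun_prop
  have cA := cont_helper hy hA.cA k2 m2
  have cA1 := cont_helper hy hA.cA1 k2 m2
  have cB := cont_helper hx hB.cA k1 m1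
  have cB1 := cont_helper hx hB.cA1 k1 m1
  have e1 : ContinuousOn (fun p : ℝ × E3 => p.1 * exp h)
      (Set.Ioo (-T0) T0 ×ˢ Metric.sphere 0 R) := by fun_prop
  have e2 : ContinuousOn (fun p : ℝ × E3 => p.1 * exp (-h))
      (Set.Ioo (-T0) T0 ×ˢ Metric.sphere 0 R) := by fun_prop
  refine sph_deriv hR hτ (F := fun τ z =>
    τ * (A (τ * exp (-h)) (inner ℝ y z) * B (τ * exp h) (inner ℝ x z)))
    (F' := fun τ z => (A (τ * exp (-h)) (inner ℝ y z) * B (τ * exp h) (inner ℝ x z)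
        + (τ * exp (-h)) * (A1 (τ * exp (-h)) (inner ℝ y z) * B (τ * exp h) (inner ℝ x z))
        + (τ * exp h) * (A (τ * exp (-h)) (inner ℝ y z) * B1 (τ * exp h) (inner ℝ x z))))
    (slice_helper (continuousOn_fst.mul (cA.mul cB)))
    (((cA.mul cB).add (e2.mul (cA1.mul cB))).add (e1.mul (cA.mul cB1))) ?_
  intro z hz t ht
  have dA : HasDerivAt (fun t => A (t * exp (-h)) (inner ℝ y z))
      (A1 (t * exp (-h)) (inner ℝ y z) * (1 * exp (-h))) t :=
    HasDerivAt.comp (h₂ := fun r => A r (inner ℝ y z)) t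
      (hA.dr _ (m2 t ht) _ (inner_mem_Icc hy hz)) ((hasDerivAt_id t).mul_const _)
  have dB : HasDerivAt (fun t => B (t * exp h) (inner ℝ x z))
      (B1 (t * exp h) (inner ℝ x z) * (1 * exp h)) t :=
    HasDerivAt.comp (h₂ := fun r => B r (inner ℝ x z)) t
      (hB.dr _ (m1 t ht) _ (inner_mem_Icc hx hz)) ((hasDerivAt_id t).mul_const _)
  exact ((hasDerivAt_id t).mul (dA.mul dB)).congr_deriv (by simp only [Pi.mul_apply, id]; ring)

lemma W_deriv_h (hR : 0 < R) (hA : Zon R lam A A1 A2 Ac Acc) (hB : Zon R lam B B1 B2 Bc Bcc)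
    {x y : E3} (hx : ‖x‖ = 1) (hy : ‖y‖ = 1) {T0 H0 τ h : ℝ} (hTR : T0 * exp H0 ≤ R)
    (hτ : τ ∈ Set.Ioo (-T0) T0) (hh : h ∈ Set.Ioo (-H0) H0) :
    HasDerivAt (fun h =>
      (∫ z, (A (τ * exp (-h)) (inner ℝ y z) * B (τ * exp h) (inner ℝ x z)
        + (τ * exp (-h)) * (A1 (τ * exp (-h)) (inner ℝ y z) * B (τ * exp h) (inner ℝ x z))
        + (τ * exp h) * (A (τ * exp (-h)) (inner ℝ y z) * B1 (τ * exp h) (inner ℝ x z)))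
        ∂(sph R)))
      (-(lam ^ 2 * τ * (exp h ^ 2 - exp (-h) ^ 2)) *
        ∫ z, τ * (A (τ * exp (-h)) (inner ℝ y z) * B (τ * exp h) (inner ℝ x z)) ∂(sph R)) h := by
  have m1 : ∀ h ∈ Set.Ioo (-H0) H0, τ * exp h ∈ Set.Ioo (-R) R :=
    fun h hh => rad_mem hTR hτ hh.2.le
  have m2 : ∀ h ∈ Set.Ioo (-H0) H0, τ * exp (-h) ∈ Set.Ioo (-R) R :=
    fun h hh => rad_mem hTR hτ (by linarith [hh.1])
  have k1 : Continuous fun h : ℝ => τ * exp h := by fun_prop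
  have k2 : Continuous fun h : ℝ => τ * exp (-h) := by fun_prop
  have cA := cont_helper hy hA.cA k2 m2
  have cA1 := cont_helper hy hA.cA1 k2 m2
  have cA2 := cont_helper hy hA.cA2 k2 m2
  have cB := cont_helper hx hB.cA k1 m1
  have cB1 := cont_helper hx hB.cA1 k1 m1
  have cB2 := cont_helper hx hB.cA2 k1 m1
  let F' : ℝ → E3 → ℝ := fun h z =>
    A (τ * exp (-h)) (inner ℝ y z) * (2 * (τ * exp h) * B1 (τ * exp h) (inner ℝ x z)
      + (τ * exp h) ^ 2 * B2 (τ * exp h) (inner ℝ x z))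
    - (2 * (τ * exp (-h)) * A1 (τ * exp (-h)) (inner ℝ y z)
      + (τ * exp (-h)) ^ 2 * A2 (τ * exp (-h)) (inner ℝ y z)) * B (τ * exp h) (inner ℝ x z)
  have e1 : ContinuousOn (fun p : ℝ × E3 => τ * exp p.1)
      (Set.Ioo (-H0) H0 ×ˢ Metric.sphere 0 R) := by fun_prop
  have e2 : ContinuousOn (fun p : ℝ × E3 => τ * exp (-p.1))
      (Set.Ioo (-H0) H0 ×ˢ Metric.sphere 0 R) := by fun_prop
  have cF' : ContinuousOn (fun p : ℝ × E3 => F' p.1 p.2)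
      (Set.Ioo (-H0) H0 ×ˢ Metric.sphere 0 R) :=
    (cA.mul (((continuousOn_const.mul e1).mul cB1).add ((e1.pow 2).mul cB2))).sub
      ((((continuousOn_const.mul e2).mul cA1).add ((e2.pow 2).mul cA2)).mul cB)
  have key := sph_deriv hR hh (F := fun h z =>
      (A (τ * exp (-h)) (inner ℝ y z) * B (τ * exp h) (inner ℝ x z)
        + (τ * exp (-h)) * (A1 (τ * exp (-h)) (inner ℝ y z) * B (τ * exp h) (inner ℝ x z))
        + (τ * exp h) * (A (τ * exp (-h)) (inner ℝ y z) * B1 (τ * exp h) (inner ℝ x z))))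
    (F' := F')
    (slice_helper (((cA.mul cB).add (e2.mul (cA1.mul cB))).add (e1.mul (cA.mul cB1)))) cF' ?_
  · refine key.congr_deriv ?_
    have hr := m1 h hh
    have hs := m2 h hh
    have sa := selfadj hR hx hy (f := A (τ * exp (-h))) (g := B (τ * exp h))
      (hA.dc _ hs) (hA.dcc _ hs)
      (hA.cAcc.comp (f := fun c : ℝ => (τ * exp (-h), c)) (by fun_prop) (fun c hc => ⟨hs, hc⟩))
      (hB.dc _ hr) (hB.dcc _ hr)
      (hB.cAcc.comp (f := fun c : ℝ => (τ * exp h, c)) (by fun_prop) (fun c hc => ⟨hr, hc⟩))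
    have iF : Integrable (F' h) (sph R) := sph_int_cont hR (slice_helper cF' h hh)
    have iG : Integrable (fun z => τ * (A (τ * exp (-h)) (inner ℝ y z) *
        B (τ * exp h) (inner ℝ x z))) (sph R) :=
      sph_int_cont hR (slice_helper (X := fun h z => τ * (A (τ * exp (-h)) (inner ℝ y z) *
        B (τ * exp h) (inner ℝ x z))) (continuousOn_const.mul (cA.mul cB)) h hh)
    rw [← sub_eq_zero, ← integral_const_mul, ← integral_sub iF (iG.const_mul _), ← neg_eq_zero,
      ← integral_neg, ← sa]
    refine integral_congr_ae ((sph_ae R).mono ?_)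
    intro z hz
    have pA := hA.pde _ hs _ (inner_mem_Icc hy hz)
    have pB := hB.pde _ hr _ (inner_mem_Icc hx hz)
    simp only [F']
    linear_combination (-A (τ * exp (-h)) (inner ℝ y z)) * pB
      + B (τ * exp h) (inner ℝ x z) * pA
  · intro z hz h hh
    have de1 : HasDerivAt (fun h => τ * exp h) (τ * exp h) h := (hasDerivAt_exp h).const_mul τ
    have de2 : HasDerivAt (fun h => τ * exp (-h)) (-(τ * exp (-h))) h :=
      ((hasDerivAt_neg h).exp.const_mul τ).congr_deriv (by ring)
    have dA := HasDerivAt.comp (h₂ := fun r => A r (inner ℝ y z)) h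
      (hA.dr _ (m2 h hh) _ (inner_mem_Icc hy hz)) de2
    have dA1 := HasDerivAt.comp (h₂ := fun r => A1 r (inner ℝ y z)) h
      (hA.drr _ (m2 h hh) _ (inner_mem_Icc hy hz)) de2
    have dB := HasDerivAt.comp (h₂ := fun r => B r (inner ℝ x z)) h
      (hB.dr _ (m1 h hh) _ (inner_mem_Icc hx hz)) de1
    have dB1 := HasDerivAt.comp (h₂ := fun r => B1 r (inner ℝ x z)) h
      (hB.drr _ (m1 h hh) _ (inner_mem_Icc hx hz)) de1
    refine (((dA.mul dB).add (de2.mul (dA1.mul dB))).add (de1.mul (dA.mul dB1))).congr_deriv ?_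
    simp only [Pi.mul_apply, Function.comp_def, F']
    ring

lemma W_even (hR : 0 < R) (hA : Zon R lam A A1 A2 Ac Acc) (hB : Zon R lam B B1 B2 Bc Bcc)
    {x y : E3} (hx : ‖x‖ = 1) (hy : ‖y‖ = 1) {T0 H0 T H : ℝ} (hTR : T0 * exp H0 ≤ R)
    (hT : 0 ≤ T) (hT0 : T < T0) (hH : 0 ≤ H) (hH0 : H < H0) :
    ∫ z, T * (A (T * exp (-H)) (inner ℝ y z) * B (T * exp H) (inner ℝ x z)) ∂(sph R)
      = ∫ z, T * (A (T * exp H) (inner ℝ y z) * B (T * exp (-H)) (inner ℝ x z)) ∂(sph R) := by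
  have := sph_finite R hR
  let W : ℝ → ℝ → ℝ := fun τ h =>
    ∫ z, τ * (A (τ * exp (-h)) (inner ℝ y z) * B (τ * exp h) (inner ℝ x z)) ∂(sph R)
  let W1 : ℝ → ℝ → ℝ := fun τ h =>
    ∫ z, (A (τ * exp (-h)) (inner ℝ y z) * B (τ * exp h) (inner ℝ x z)
        + (τ * exp (-h)) * (A1 (τ * exp (-h)) (inner ℝ y z) * B (τ * exp h) (inner ℝ x z))
        + (τ * exp h) * (A (τ * exp (-h)) (inner ℝ y z) * B1 (τ * exp h) (inner ℝ x z)))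
        ∂(sph R)
  have mτ : ∀ τ ∈ Set.Icc 0 T, τ ∈ Set.Ioo (-T0) T0 :=
    fun τ h => ⟨by linarith [h.1], by linarith [h.2]⟩
  have mh : ∀ h ∈ Set.Icc 0 H, h ∈ Set.Ioo (-H0) H0 :=
    fun τ h => ⟨by linarith [h.1], by linarith [h.2]⟩
  have mh' : ∀ h ∈ Set.Icc 0 H, -h ∈ Set.Ioo (-H0) H0 :=
    fun τ h => ⟨by linarith [h.2], by linarith [h.1]⟩
  -- boundedness
  let M := T * exp H
  have hM : M ∈ Set.Ioo (-R) R := rad_mem hTR (mτ T ⟨hT, le_rfl⟩) hH0.le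
  have hMs : Set.Icc (-M) M ⊆ Set.Ioo (-R) R :=
    Set.Icc_subset_Ioo (by linarith [hM.2]) hM.2
  obtain ⟨CA, hCA⟩ := (isCompact_Icc.prod (isCompact_Icc)).exists_bound_of_continuousOn
    (hA.cA.mono (Set.prod_mono hMs subset_rfl))
  obtain ⟨CB, hCB⟩ := (isCompact_Icc.prod (isCompact_Icc)).exists_bound_of_continuousOn
    (hB.cA.mono (Set.prod_mono hMs subset_rfl))
  have mM : ∀ τ ∈ Set.Icc 0 T, ∀ h ≤ H, τ * exp h ∈ Set.Icc (-M) M := by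
    intro τ hτ h hh
    have h1 : τ * exp h ≤ M := by
      have := exp_le_exp.2 hh
      have := hτ.2
      simp only [M]; gcongr
    have h2 : 0 ≤ τ * exp h := mul_nonneg hτ.1 (exp_pos _).le
    exact ⟨by linarith, h1⟩
  have bW : ∀ τ ∈ Set.Icc 0 T, ∀ h, h ≤ H → -h ≤ H →
      |W τ h| ≤ T * (CA * CB) * (sph R).real Set.univ := by
    intro τ hτ h hh hh'
    rw [← Real.norm_eq_abs]
    refine norm_integral_le_of_norm_le_const (μ := sph R) ((sph_ae R).mono fun z hz => ?_)
    have a1 := hCA (τ * exp (-h), inner ℝ y z) ⟨mM τ hτ _ hh', inner_mem_Icc hy hz⟩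
    have a2 := hCB (τ * exp h, inner ℝ x z) ⟨mM τ hτ _ hh, inner_mem_Icc hx hz⟩
    have a3 : ‖τ‖ ≤ T := by rw [Real.norm_eq_abs, abs_of_nonneg hτ.1]; exact hτ.2
    rw [norm_mul, norm_mul]
    have : 0 ≤ CA := (norm_nonneg _).trans a1
    gcongr
  have g := goursat (T := T) (H := H) (k := lam ^ 2 * T * exp H ^ 2) hH (by positivity)
    (w := fun τ h => W τ h - W τ (-h)) (w1 := fun τ h => W1 τ h - W1 τ (-h))
    (w2 := fun τ h => -(lam ^ 2 * τ * (exp h ^ 2 - exp (-h) ^ 2)) * (W τ h - W τ (-h)))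
    (fun τ hτ h hh => (W_deriv_tau hR hA hB hx hy hTR (mτ τ hτ) (mh h hh)).sub
      (W_deriv_tau hR hA hB hx hy hTR (mτ τ hτ) (mh' h hh)))
    (by
      intro τ hτ h hh
      have d1 := W_deriv_h hR hA hB hx hy hTR (mτ τ hτ) (mh h hh)
      have d2 := W_deriv_h hR hA hB hx hy hTR (mτ τ hτ) (mh' h hh)
      have d3 := HasDerivAt.comp h d2 (hasDerivAt_neg h)
      refine (d1.sub d3).congr_deriv ?_
      simp only [W, neg_neg]
      ring)
    (by
      intro τ hτ h hh
      rw [abs_mul]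
      gcongr
      rw [abs_neg, abs_mul, abs_mul, abs_of_nonneg (sq_nonneg lam), abs_of_nonneg hτ.1]
      have e1 : exp (-h) ≤ exp h := exp_le_exp.2 (by linarith [hh.1])
      have e2 : exp h ≤ exp H := exp_le_exp.2 hh.2
      have e3 := exp_pos (-h)
      have e4 := exp_pos h
      have e5 : |exp h ^ 2 - exp (-h) ^ 2| ≤ exp H ^ 2 := by
        rw [abs_le]; constructor <;> nlinarith
      have := hτ.2
      gcongr)
    (by intro h _; simp [W])
    (by intro τ _; simp)
    (T * (CA * CB) * (sph R).real Set.univ + T * (CA * CB) * (sph R).real Set.univ)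
    (by
      intro τ hτ h hh
      have h1 := bW τ hτ h hh.2 (by linarith [hh.1])
      have h2 := bW τ hτ (-h) (by linarith [hh.1]) (by simpa using hh.2)
      exact (abs_sub _ _).trans (add_le_add h1 h2))
    T ⟨hT, le_rfl⟩ H ⟨hH, le_rfl⟩
  have := sub_eq_zero.1 g
  simpa only [W, neg_neg] using this

lemma zon_sym_pos (hR : 0 < R) (hA : Zon R lam A A1 A2 Ac Acc) (hB : Zon R lam B B1 B2 Bc Bcc)
    {x y : E3} (hx : ‖x‖ = 1) (hy : ‖y‖ = 1) {r s : ℝ} (hs : 0 < s) (hsr : s ≤ r) (hr : r < R) :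
    ∫ z, A s (inner ℝ y z) * B r (inner ℝ x z) ∂(sph R)
      = ∫ z, A r (inner ℝ y z) * B s (inner ℝ x z) ∂(sph R) := by
  have hr0 : 0 < r := hs.trans_le hsr
  obtain ⟨u, hu⟩ : ∃ u, u = log r := ⟨_, rfl⟩
  obtain ⟨v, hv⟩ : ∃ v, v = log s := ⟨_, rfl⟩
  obtain ⟨q, hq⟩ : ∃ q, q = log R := ⟨_, rfl⟩
  have huv : v ≤ u := by rw [hu, hv]; exact log_le_log hs hsr
  have huq : u < q := by rw [hu, hq]; exact log_lt_log hr0 hr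
  have e := W_even hR hA hB hx hy (T := exp ((u + v) / 2)) (H := (u - v) / 2)
    (T0 := exp ((u + v) / 2 + (q - u) / 2)) (H0 := (u - v) / 2 + (q - u) / 2)
    (by rw [← exp_add, show (u + v) / 2 + (q - u) / 2 + ((u - v) / 2 + (q - u) / 2) = q by ring,
      hq, exp_log hR]) (exp_pos _).le (exp_lt_exp.2 (by linarith)) (by linarith) (by linarith)
  rw [← exp_add, ← exp_add, show (u + v) / 2 + (u - v) / 2 = u by ring,
    show (u + v) / 2 + -((u - v) / 2) = v by ring, hu, hv, exp_log hr0, exp_log hs,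
    integral_const_mul, integral_const_mul] at e
  exact mul_left_cancel₀ (exp_pos _).ne' e

lemma zon_sym_zero (hR : 0 < R) (hA : Zon R lam A A1 A2 Ac Acc) (hB : Zon R lam B B1 B2 Bc Bcc)
    {x y : E3} (hx : ‖x‖ = 1) (hy : ‖y‖ = 1) {r : ℝ} (hr0 : 0 < r) (hr : r < R) :
    ∫ z, A 0 (inner ℝ y z) * B r (inner ℝ x z) ∂(sph R)
      = ∫ z, A r (inner ℝ y z) * B 0 (inner ℝ x z) ∂(sph R) := by
  have hrm : r ∈ Set.Ioo (-R) R := ⟨by linarith, hr⟩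
  have h0m : (0 : ℝ) ∈ Set.Ioo (-R) R := ⟨by linarith, hR⟩
  have cA := cont_helper hy hA.cA continuous_id (fun t ht => ht)
  have cA1 := cont_helper hy hA.cA1 continuous_id (fun t ht => ht)
  have cB := cont_helper hx hB.cA continuous_id (fun t ht => ht)
  have cB1 := cont_helper hx hB.cA1 continuous_id (fun t ht => ht)
  have kA := cont_helper (a := -R) (b := R) hy hA.cA (continuous_const (y := r)) (fun t ht => hrm)
  have kB := cont_helper (a := -R) (b := R) hx hB.cA (continuous_const (y := r)) (fun t ht => hrm)
  simp only [id] at cA cA1 cB cB1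
  have d1 := sph_deriv hR h0m (F := fun s z => A s (inner ℝ y z) * B r (inner ℝ x z))
    (F' := fun s z => A1 s (inner ℝ y z) * B r (inner ℝ x z))
    (slice_helper (cA.mul kB)) (cA1.mul kB)
    (fun z hz t ht => (hA.dr t ht _ (inner_mem_Icc hy hz)).mul_const _)
  have d2 := sph_deriv hR h0m (F := fun s z => A r (inner ℝ y z) * B s (inner ℝ x z))
    (F' := fun s z => A r (inner ℝ y z) * B1 s (inner ℝ x z))
    (slice_helper (kA.mul cB)) (kA.mul cB1)
    (fun z hz t ht => (hB.dr t ht _ (inner_mem_Icc hx hz)).const_mul _)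
  have l1 := d1.continuousAt.tendsto.mono_left (nhdsWithin_le_nhds (s := Set.Ioi 0))
  have l2 := d2.continuousAt.tendsto.mono_left (nhdsWithin_le_nhds (s := Set.Ioi 0))
  refine tendsto_nhds_unique (l1.congr' ?_) l2
  filter_upwards [Ioo_mem_nhdsGT hr0] with s hs
  exact zon_sym_pos hR hA hB hx hy hs.1 hs.2.le hr

lemma zon_sym (hR : 0 < R) (hA : Zon R lam A A1 A2 Ac Acc) (hB : Zon R lam B B1 B2 Bc Bcc)
    {x y : E3} (hx : ‖x‖ = 1) (hy : ‖y‖ = 1) {r s : ℝ} (hs0 : 0 ≤ s) (hr0 : 0 ≤ r)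
    (hs : s < R) (hr : r < R) :
    ∫ z, A s (inner ℝ y z) * B r (inner ℝ x z) ∂(sph R)
      = ∫ z, A r (inner ℝ y z) * B s (inner ℝ x z) ∂(sph R) := by
  rcases hs0.eq_or_lt with rfl | hs0
  · rcases hr0.eq_or_lt with rfl | hr0
    · rfl
    · exact zon_sym_zero hR hA hB hx hy hr0 hr
  · rcases hr0.eq_or_lt with rfl | hr0
    · exact (zon_sym_zero hR hA hB hx hy hs0 hs).symm
    · rcases le_total s r with h | h
      · exact zon_sym_pos hR hA hB hx hy hs0 h hr
      · exact (zon_sym_pos hR hA hB hx hy hr0 h hs).symm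

end

/-- Radial Helmholtz functions in the variable `w = |z|^2`. -/
structure Rad (lam : ℝ) (P P1 : ℝ → ℝ) : Prop where
  d0 : ∀ w, 0 < w → HasDerivAt P (P1 w) w
  d1 : ∀ w, 0 < w → HasDerivAt P1 (-(6 * P1 w + lam ^ 2 * P w) / (4 * w)) w

lemma w_pos {R r c : ℝ} (hr : r ∈ Set.Ioo (-R) R) (hc : c ∈ Set.Icc (-R) R) :
    0 < R ^ 2 - 2 * r * c + r ^ 2 := by
  have h1 : |r| < R := abs_lt.2 hr
  have h2 : |c| ≤ R := abs_le.2 hc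
  have h3 : r * c ≤ |r| * R := (le_abs_self _).trans (by rw [abs_mul]; gcongr)
  have h4 : 0 < (R - |r|) ^ 2 := by have : 0 < R - |r| := by linarith
                                    positivity
  have h5 := sq_abs r
  nlinarith

lemma w_dr (R r c : ℝ) : HasDerivAt (fun r => R ^ 2 - 2 * r * c + r ^ 2) (2 * r - 2 * c) r := by
  refine (((((hasDerivAt_id r).const_mul 2).mul_const c).const_sub (R ^ 2)).add
    ((hasDerivAt_id r).pow 2)).congr_deriv ?_
  simp; ring

lemma w_dc (R r c : ℝ) : HasDerivAt (fun c => R ^ 2 - 2 * r * c + r ^ 2) (-2 * r) c := by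
  refine ((((hasDerivAt_id c).const_mul (2 * r)).const_sub (R ^ 2)).add_const (r ^ 2)).congr_deriv ?_
  simp

section
variable {R lam : ℝ} {P P1 : ℝ → ℝ}

lemma w_cont {Q : ℝ → ℝ} (hQ : ∀ w, 0 < w → ContinuousAt Q w) :
    ContinuousOn (fun p : ℝ × ℝ => Q (R ^ 2 - 2 * p.1 * p.2 + p.1 ^ 2))
      (Set.Ioo (-R) R ×ˢ Set.Icc (-R) R) := by
  have hQ' : ContinuousOn Q (Set.Ioi 0) := fun w hw => (hQ w hw).continuousWithinAt
  exact hQ'.comp (f := fun p : ℝ × ℝ => R ^ 2 - 2 * p.1 * p.2 + p.1 ^ 2) (by fun_prop)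
    (fun p hp => w_pos hp.1 hp.2)

lemma Rad.d2 (h : Rad lam P P1) : ∀ w, 0 < w →
    HasDerivAt (fun w => -(6 * P1 w + lam ^ 2 * P w) / (4 * w))
      (-(10 * (-(6 * P1 w + lam ^ 2 * P w) / (4 * w)) + lam ^ 2 * P1 w) / (4 * w)) w := by
  intro w hw
  refine (((((h.d1 w hw).const_mul 6).add ((h.d0 w hw).const_mul (lam ^ 2))).neg).div
    ((hasDerivAt_id w).const_mul 4) (by simp; positivity)).congr_deriv ?_
  simp only [id, Pi.add_apply, Pi.neg_apply]
  field_simp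
  ring

lemma zonA (h : Rad lam P P1) : ∃ A1 A2 Ac Acc,
    Zon R lam (fun r c => P (R ^ 2 - 2 * r * c + r ^ 2)) A1 A2 Ac Acc := by
  obtain ⟨P2, hP2⟩ : ∃ P2 : ℝ → ℝ, P2 = fun w => -(6 * P1 w + lam ^ 2 * P w) / (4 * w) := ⟨_, rfl⟩
  have d0 := h.d0
  have d1 : ∀ w, 0 < w → HasDerivAt P1 (P2 w) w := by rw [hP2]; exact h.d1
  have ode : ∀ w, 0 < w → 4 * w * P2 w + 6 * P1 w + lam ^ 2 * P w = 0 := by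
    intro w hw; rw [hP2]; field_simp; ring
  have c0 := w_cont (R := R) (fun w hw => (d0 w hw).continuousAt)
  have c1 := w_cont (R := R) (fun w hw => (d1 w hw).continuousAt)
  have c2 : ContinuousOn (fun p : ℝ × ℝ => P2 (R ^ 2 - 2 * p.1 * p.2 + p.1 ^ 2))
      (Set.Ioo (-R) R ×ˢ Set.Icc (-R) R) :=
    w_cont (fun w hw => by rw [hP2]; exact (h.d2 w hw).continuousAt)
  refine ⟨fun r c => P1 (R ^ 2 - 2 * r * c + r ^ 2) * (2 * r - 2 * c),
    fun r c => P2 (R ^ 2 - 2 * r * c + r ^ 2) * (2 * r - 2 * c) ^ 2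
      + P1 (R ^ 2 - 2 * r * c + r ^ 2) * 2,
    fun r c => P1 (R ^ 2 - 2 * r * c + r ^ 2) * (-2 * r),
    fun r c => P2 (R ^ 2 - 2 * r * c + r ^ 2) * (4 * r ^ 2), ?_, ?_, ?_, ?_, ?_, ?_, ?_, ?_, ?_⟩
  · intro r hr c hc
    exact HasDerivAt.comp (h₂ := P) r (d0 _ (w_pos hr hc)) (w_dr R r c)
  · intro r hr c hc
    have e1 := HasDerivAt.comp (h₂ := P1) r (d1 _ (w_pos hr hc)) (w_dr R r c)
    refine (e1.mul (((hasDerivAt_id r).const_mul 2).sub_const (2 * c))).congr_deriv ?_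
    simp only [Function.comp_def, id]; ring
  · intro r hr c hc
    exact HasDerivAt.comp (h₂ := P) c (d0 _ (w_pos hr hc)) (w_dc R r c)
  · intro r hr c hc
    have e1 := HasDerivAt.comp (h₂ := P1) c (d1 _ (w_pos hr hc)) (w_dc R r c)
    exact (e1.mul_const (-2 * r)).congr_deriv (by ring)
  · exact c0
  · exact c1.mul (by fun_prop)
  · exact (c2.mul (by fun_prop)).add (c1.mul (by fun_prop))
  · exact c2.mul (by fun_prop)
  · intro r hr c hc
    linear_combination r ^ 2 * ode _ (w_pos hr hc)

lemma zonB (h : Rad lam P P1) : ∃ A1 A2 Ac Acc,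
    Zon R lam (fun r c => P1 (R ^ 2 - 2 * r * c + r ^ 2) * (R ^ 2 - r * c)) A1 A2 Ac Acc := by
  obtain ⟨P2, hP2⟩ : ∃ P2 : ℝ → ℝ, P2 = fun w => -(6 * P1 w + lam ^ 2 * P w) / (4 * w) := ⟨_, rfl⟩
  obtain ⟨P3, hP3⟩ : ∃ P3 : ℝ → ℝ, P3 = fun w => -(10 * P2 w + lam ^ 2 * P1 w) / (4 * w) :=
    ⟨_, rfl⟩
  have d1 : ∀ w, 0 < w → HasDerivAt P1 (P2 w) w := by rw [hP2]; exact h.d1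
  have d2 : ∀ w, 0 < w → HasDerivAt P2 (P3 w) w := by rw [hP3, hP2]; exact h.d2
  have ode : ∀ w, 0 < w → 4 * w * P3 w + 10 * P2 w + lam ^ 2 * P1 w = 0 := by
    intro w hw; rw [hP3]; field_simp; ring
  have c1 := w_cont (R := R) (fun w hw => (d1 w hw).continuousAt)
  have c2 := w_cont (R := R) (fun w hw => (d2 w hw).continuousAt)
  have c3 : ContinuousOn (fun p : ℝ × ℝ => P3 (R ^ 2 - 2 * p.1 * p.2 + p.1 ^ 2))
      (Set.Ioo (-R) R ×ˢ Set.Icc (-R) R) := by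
    refine w_cont (fun w hw => ?_)
    rw [hP3]
    have k1 := (d1 w hw).continuousAt
    have k2 := (d2 w hw).continuousAt
    have : 4 * w ≠ 0 := by positivity
    fun_prop (disch := assumption)
  have er : ∀ r c : ℝ, HasDerivAt (fun r => R ^ 2 - r * c) (-c) r := fun r c =>
    (((hasDerivAt_id r).mul_const c).const_sub (R ^ 2)).congr_deriv (by ring)
  have ec : ∀ r c : ℝ, HasDerivAt (fun c => R ^ 2 - r * c) (-r) c := fun r c =>
    (((hasDerivAt_id c).const_mul r).const_sub (R ^ 2)).congr_deriv (by ring)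
  refine ⟨fun r c => P2 (R ^ 2 - 2 * r * c + r ^ 2) * ((2 * r - 2 * c) * (R ^ 2 - r * c))
      + P1 (R ^ 2 - 2 * r * c + r ^ 2) * (-c),
    fun r c => P3 (R ^ 2 - 2 * r * c + r ^ 2) * ((2 * r - 2 * c) ^ 2 * (R ^ 2 - r * c))
      + P2 (R ^ 2 - 2 * r * c + r ^ 2) * (2 * (R ^ 2 - r * c) - 2 * c * (2 * r - 2 * c)),
    fun r c => P2 (R ^ 2 - 2 * r * c + r ^ 2) * (-2 * r * (R ^ 2 - r * c))
      + P1 (R ^ 2 - 2 * r * c + r ^ 2) * (-r),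
    fun r c => P3 (R ^ 2 - 2 * r * c + r ^ 2) * (4 * r ^ 2 * (R ^ 2 - r * c))
      + P2 (R ^ 2 - 2 * r * c + r ^ 2) * (4 * r ^ 2), ?_, ?_, ?_, ?_, ?_, ?_, ?_, ?_, ?_⟩
  · intro r hr c hc
    have e1 := HasDerivAt.comp (h₂ := P1) r (d1 _ (w_pos hr hc)) (w_dr R r c)
    refine (e1.mul (er r c)).congr_deriv ?_
    simp only [Function.comp_def]; ring
  · intro r hr c hc
    have e1 := HasDerivAt.comp (h₂ := P1) r (d1 _ (w_pos hr hc)) (w_dr R r c)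
    have e2 := HasDerivAt.comp (h₂ := P2) r (d2 _ (w_pos hr hc)) (w_dr R r c)
    refine ((e2.mul ((((hasDerivAt_id r).const_mul 2).sub_const (2 * c)).mul (er r c))).add
      (e1.mul_const (-c))).congr_deriv ?_
    simp only [Function.comp_def, id, Pi.mul_apply]; ring
  · intro r hr c hc
    have e1 := HasDerivAt.comp (h₂ := P1) c (d1 _ (w_pos hr hc)) (w_dc R r c)
    refine (e1.mul (ec r c)).congr_deriv ?_
    simp only [Function.comp_def]; ring
  · intro r hr c hc
    have e1 := HasDerivAt.comp (h₂ := P1) c (d1 _ (w_pos hr hc)) (w_dc R r c)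
    have e2 := HasDerivAt.comp (h₂ := P2) c (d2 _ (w_pos hr hc)) (w_dc R r c)
    refine ((e2.mul ((ec r c).const_mul (-2 * r))).add
      (e1.mul_const (-r))).congr_deriv ?_
    simp only [Function.comp_def]; ring
  · exact c1.mul (by fun_prop)
  · exact (c2.mul (by fun_prop)).add (c1.mul (by fun_prop))
  · exact (c3.mul (by fun_prop)).add (c2.mul (by fun_prop))
  · exact (c3.mul (by fun_prop)).add (c2.mul (by fun_prop))
  · intro r hr c hc
    linear_combination r ^ 2 * (R ^ 2 - r * c) * ode _ (w_pos hr hc)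

end

lemma radN {lam : ℝ} (hl : 0 < lam) : Rad lam (fun w => -cos (lam * √w) / (lam * √w))
    (fun w => (lam * √w * sin (lam * √w) + cos (lam * √w)) / (2 * lam * √w ^ 3)) := by
  have hq : ∀ w : ℝ, 0 < w → HasDerivAt (fun w => lam * √w) (lam * (1 / (2 * √w))) w :=
    fun w hw => (hasDerivAt_sqrt hw.ne').const_mul lam
  constructor
  · intro w hw
    have hw' : 0 < √w := sqrt_pos.2 hw
    refine ((hq w hw).cos.neg.div (hq w hw) (by positivity)).congr_deriv ?_
    simp only [Pi.neg_apply]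
    field_simp
    ring
  · intro w hw
    have hw' : 0 < √w := sqrt_pos.2 hw
    have h4 : w = √w ^ 2 := (sq_sqrt hw.le).symm
    refine ((((hq w hw).mul (hq w hw).sin).add (hq w hw).cos).div
      (((hasDerivAt_sqrt hw.ne').pow 3).const_mul (2 * lam))
      (ne_of_gt (by show 0 < 2 * lam * √w ^ 3; positivity))).congr_deriv ?_
    simp only [Pi.add_apply, Pi.mul_apply, Pi.pow_apply]
    generalize sin (lam * √w) = S
    generalize cos (lam * √w) = C
    generalize √w = q at *
    subst h4
    field_simp
    ring

lemma radJ {lam : ℝ} (hl : 0 < lam) : Rad lam (fun w => sin (lam * √w) / (lam * √w))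
    (fun w => (lam * √w * cos (lam * √w) - sin (lam * √w)) / (2 * lam * √w ^ 3)) := by
  have hq : ∀ w : ℝ, 0 < w → HasDerivAt (fun w => lam * √w) (lam * (1 / (2 * √w))) w :=
    fun w hw => (hasDerivAt_sqrt hw.ne').const_mul lam
  constructor
  · intro w hw
    have hw' : 0 < √w := sqrt_pos.2 hw
    refine ((hq w hw).sin.div (hq w hw) (by positivity)).congr_deriv ?_
    field_simp
  · intro w hw
    have hw' : 0 < √w := sqrt_pos.2 hw
    have h4 : w = √w ^ 2 := (sq_sqrt hw.le).symm
    refine ((((hq w hw).mul (hq w hw).cos).sub (hq w hw).sin).div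
      (((hasDerivAt_sqrt hw.ne').pow 3).const_mul (2 * lam))
      (ne_of_gt (by show 0 < 2 * lam * √w ^ 3; positivity))).congr_deriv ?_
    simp only [Pi.sub_apply, Pi.mul_apply, Pi.pow_apply]
    generalize sin (lam * √w) = S
    generalize cos (lam * √w) = C
    generalize √w = q at *
    subst h4
    field_simp
    ring

lemma exists_unit (x : E3) : ∃ u : E3, ‖u‖ = 1 ∧ x = ‖x‖ • u := by
  by_cases hx : x = 0
  · exact ⟨EuclideanSpace.single 0 1, by simp, by simp [hx]⟩
  · have : ‖x‖ ≠ 0 := norm_ne_zero_iff.2 hx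
    refine ⟨‖x‖⁻¹ • x, by rw [norm_smul]; simp [this], by rw [smul_smul]; simp [this]⟩

lemma dist_sq_formula {R r : ℝ} {u z : E3} (hu : ‖u‖ = 1) (hz : ‖z‖ = R) :
    ‖z - r • u‖ ^ 2 = R ^ 2 - 2 * r * inner ℝ u z + r ^ 2 := by
  rw [norm_sub_sq_real, norm_smul, hu, hz, real_inner_smul_right, real_inner_comm, mul_one,
    Real.norm_eq_abs, sq_abs]
  ring

lemma n0_formula {R lam r : ℝ} {u z : E3} (hu : ‖u‖ = 1) (hz : ‖z‖ = R) :
    n0 (lam * ‖r • u - z‖) = (fun w => -cos (lam * √w) / (lam * √w))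
      (R ^ 2 - 2 * r * inner ℝ u z + r ^ 2) := by
  simp only
  rw [← dist_sq_formula hu hz, sqrt_sq (norm_nonneg _), norm_sub_rev, n0]

lemma fderiv_formula {R lam r : ℝ} (hl : 0 < lam) {u z : E3} (hu : ‖u‖ = 1)
    (hz : z ∈ Metric.sphere (0 : E3) R) (hr : r ∈ Set.Ioo (-R) R) :
    fderiv ℝ (fun w => j0 (lam * ‖w - r • u‖)) z (R⁻¹ • z) = 2 * R⁻¹ *
      ((fun w => (lam * √w * cos (lam * √w) - sin (lam * √w)) / (2 * lam * √w ^ 3))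
        (R ^ 2 - 2 * r * inner ℝ u z + r ^ 2) * (R ^ 2 - r * inner ℝ u z)) := by
  have hz' : ‖z‖ = R := by simpa using hz
  have hpos := w_pos hr (inner_mem_Icc hu hz)
  rw [← dist_sq_formula hu hz'] at hpos ⊢
  have d := (radJ hl).d0 _ hpos
  have dn : HasFDerivAt (fun w : E3 => ‖w - r • u‖ ^ 2) _ z :=
    ((hasFDerivAt_id z).sub_const (r • u)).norm_sq
  have dd := d.comp_hasFDerivAt z dn
  have hne : ∀ᶠ w in nhds z, w - r • u ≠ 0 := by
    have : ContinuousAt (fun w : E3 => w - r • u) z := by fun_prop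
    exact this.eventually_ne (by intro h; rw [h] at hpos; simp at hpos)
  have ee : (fun w => j0 (lam * ‖w - r • u‖)) =ᶠ[nhds z]
      ((fun w => sin (lam * √w) / (lam * √w)) ∘ fun w : E3 => ‖w - r • u‖ ^ 2) := by
    filter_upwards [hne] with w hw
    have h1 : lam * ‖w - r • u‖ ≠ 0 := mul_ne_zero hl.ne' (norm_ne_zero_iff.2 hw)
    simp only [Function.comp_def, j0, if_neg h1, sqrt_sq (norm_nonneg _)]
  rw [ee.fderiv_eq, dd.fderiv]
  simp [hz']
  ring
/-- For interior points `x, y` of the ball of radius `R` in `ℝ³`, the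
boundary integral `I(x,y) = ∫_{|z|=R} n₀(λ|y-z|) ∂ₙ_z j₀(λ|z-x|) dσ(z)` is symmetric:
`I(x,y) = I(y,x)`. Here `∂ₙ_z` is the outward normal derivative `(z/R)·∇_z`. -/
theorem boundary_integral_symmetry_3d
    (R lam : ℝ) (hR : 0 < R) (hlam : 0 < lam)
    (x y : EuclideanSpace ℝ (Fin 3))
    (hx : x ∈ Metric.ball (0 : EuclideanSpace ℝ (Fin 3)) R)
    (hy : y ∈ Metric.ball (0 : EuclideanSpace ℝ (Fin 3)) R) :
    (∫ z in Metric.sphere (0 : EuclideanSpace ℝ (Fin 3)) R,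
        n0 (lam * ‖y - z‖) *
          fderiv ℝ (fun w => j0 (lam * ‖w - x‖)) z (R⁻¹ • z) ∂(μH[2])) =
      ∫ z in Metric.sphere (0 : EuclideanSpace ℝ (Fin 3)) R,
        n0 (lam * ‖x - z‖) *
          fderiv ℝ (fun w => j0 (lam * ‖w - y‖)) z (R⁻¹ • z) ∂(μH[2]) := by
  obtain ⟨u, hu, hxu⟩ := exists_unit x
  obtain ⟨v, hv, hyv⟩ := exists_unit y
  have hxR : ‖x‖ < R := by simpa using hx
  have hyR : ‖y‖ < R := by simpa using hy
  have hx0 := norm_nonneg x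
  have hy0 := norm_nonneg y
  generalize ‖x‖ = r at *
  generalize ‖y‖ = s at *
  subst hxu hyv
  obtain ⟨P, hAA⟩ : ∃ P : ℝ → ℝ, (fun w => -cos (lam * √w) / (lam * √w)) = P := ⟨_, rfl⟩
  obtain ⟨Q, hBB⟩ : ∃ Q : ℝ → ℝ, (fun w => (lam * √w * cos (lam * √w) - sin (lam * √w)) /
    (2 * lam * √w ^ 3)) = Q := ⟨_, rfl⟩
  have rn := radN hlam
  rw [hAA] at rn
  have rj := radJ hlam
  rw [hBB] at rj
  obtain ⟨A1, A2, Ac, Acc, hA⟩ := zonA (R := R) rn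
  obtain ⟨B1, B2, Bc, Bcc, hB⟩ := zonB (R := R) rj
  have main := zon_sym hR hA hB hu hv hy0 hx0 hyR hxR
  have conv : ∀ (r s : ℝ) (u v : E3), ‖u‖ = 1 → ‖v‖ = 1 → r ∈ Set.Ioo (-R) R →
      (∫ z in Metric.sphere (0 : E3) R, n0 (lam * ‖s • v - z‖) *
          fderiv ℝ (fun w => j0 (lam * ‖w - r • u‖)) z (R⁻¹ • z) ∂(μH[2])) =
      2 * R⁻¹ * ∫ z, P (R ^ 2 - 2 * s * inner ℝ v z + s ^ 2) *
        (Q (R ^ 2 - 2 * r * inner ℝ u z + r ^ 2) * (R ^ 2 - r * inner ℝ u z)) ∂(sph R) := by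
    intro r s u v hu hv hr
    rw [← integral_const_mul]
    refine integral_congr_ae ((sph_ae R).mono ?_)
    intro z hz
    have hz' : ‖z‖ = R := by simpa using hz
    simp only
    rw [n0_formula hv hz', fderiv_formula hlam hu hz hr, hAA, hBB]
    ring
  rw [conv r s u v hu hv ⟨by linarith, hxR⟩, conv s r v u hv hu ⟨by linarith, hyR⟩, main]
  congr 1
  have e1 := Submodule.reflection_sub (hu.trans hv.symm)
  have e2 : Submodule.reflection (Submodule.span ℝ {u - v})ᗮ v = u := by
    have h := Submodule.reflection_reflection (Submodule.span ℝ {u - v})ᗮ u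
    rwa [e1] at h
  generalize Submodule.reflection (Submodule.span ℝ {u - v})ᗮ = e at e1 e2
  have i1 : ∀ z, inner ℝ u (e z) = inner ℝ v z := fun z => by
    conv_lhs => rw [← e2]
    exact e.inner_map_map v z
  have i2 : ∀ z, inner ℝ v (e z) = inner ℝ u z := fun z => by
    conv_lhs => rw [← e1]
    exact e.inner_map_map u z
  symm
  rw [← sph_comp R e]
  simp only [i1, i2]
end

section
/- Let Ω be the open ball of radius ρ > 0 centered at the origin in ℝ³, let λ > 0, and let u be a C² function on a neighborhood of the closure of Ω satisfying Δu + λ²u = 0 in Ω and u(z) = 0 for all z with |z| = ρ. Then for every x ∈ ℝ³ with |x| > ρ: ∫_{|z|=ρ} ( e^{iλ|x - z|} / (4π|x - z|) ) ∂_n u(z) dσ(z) = 0, where ∂_n u(z) = (z/ρ)·∇u(z) is the outward normal derivative and σ is the surface measure on the sphere |z| = ρ. -/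
open MeasureTheory Real

lemma sphere_finite_s11 (ρ : ℝ) (hρ : 0 < ρ) : μH[2] (Metric.sphere (0 : E3) ρ) < ⊤ := by
  let P : ℝ × ℝ → E3 := fun p => !₂[ρ * sin p.2 * cos p.1, ρ * sin p.2 * sin p.1, ρ * cos p.2]
  have hP : ContDiff ℝ 1 P := by
    rw [contDiff_euclidean]
    intro i
    fin_cases i <;> simp [P] <;> fun_prop
  let Q : Set (ℝ × ℝ) := Set.Icc (-π) π ×ˢ Set.Icc (-π) π
  have hQ : IsCompact Q := isCompact_Icc.prod isCompact_Icc
  obtain ⟨K, hK⟩ := LocallyLipschitzOn.exists_lipschitzOnWith_of_compact hQ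
    (hP.locallyLipschitz.locallyLipschitzOn (s := Q))
  have h1 := hK.hausdorffMeasure_image_le (d := 2) (by norm_num)
  have hsub : Metric.sphere (0 : E3) ρ ⊆ P '' Q := by
    intro z hz
    have hz' : ‖z‖ = ρ := by simpa using hz
    have hsq : z 0 ^ 2 + z 1 ^ 2 + z 2 ^ 2 = ρ ^ 2 := by
      rw [← hz', EuclideanSpace.norm_sq_eq, Fin.sum_univ_three]; simp
    let w : ℂ := ⟨z 0, z 1⟩
    let c : ℂ := ⟨z 2, ‖w‖⟩
    have hw : ‖w‖ ^ 2 = z 0 ^ 2 + z 1 ^ 2 := by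
      rw [← Complex.normSq_eq_norm_sq, Complex.normSq_apply]; ring
    have hc : ‖c‖ = ρ := by
      have : ‖c‖ ^ 2 = ρ ^ 2 := by
        rw [← Complex.normSq_eq_norm_sq, Complex.normSq_apply]
        change z 2 * z 2 + ‖w‖ * ‖w‖ = _
        nlinarith
      exact (pow_left_inj₀ (norm_nonneg _) hρ.le two_ne_zero).1 this
    have a1 := Complex.norm_mul_cos_arg w
    have a2 := Complex.norm_mul_sin_arg w
    have b1 := Complex.norm_mul_cos_arg c
    have b2 := Complex.norm_mul_sin_arg c
    rw [hc] at b1 b2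
    refine ⟨(w.arg, c.arg), ⟨⟨(Complex.neg_pi_lt_arg w).le, Complex.arg_le_pi w⟩,
      ⟨(Complex.neg_pi_lt_arg c).le, Complex.arg_le_pi c⟩⟩, ?_⟩
    have b2' : ρ * sin c.arg = ‖w‖ := b2
    ext i
    fin_cases i
    · simp [P, b2']
      rfl
    · simp [P, b2']
      rfl
    · simpa [P] using b1
  refine lt_of_le_of_lt (measure_mono hsub) (lt_of_le_of_lt h1 ?_)
  rw [hausdorffMeasure_prod_real]
  exact ENNReal.mul_lt_top (ENNReal.rpow_lt_top_of_nonneg (by norm_num) (by simp)) hQ.measure_lt_top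

/-- differentiation under the integral over a compact set -/
lemma hasDerivAt_param {K : Set E3} (hK : IsCompact K) {ν : Measure E3} (hν : ν K < ⊤)
    {a b : ℝ} {g g' : ℝ → E3 → ℂ}
    (hg : ∀ t ∈ Set.Ioo a b, ContinuousOn (g t) K)
    (hg' : ContinuousOn (fun p : ℝ × E3 => g' p.1 p.2) (Set.Icc a b ×ˢ K))
    (hd : ∀ t ∈ Set.Ioo a b, ∀ z ∈ K, HasDerivAt (fun s => g s z) (g' t z) t)
    {t : ℝ} (ht : t ∈ Set.Ioo a b) :
    HasDerivAt (fun s => ∫ z in K, g s z ∂ν) (∫ z in K, g' t z ∂ν) t := by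
  have : IsFiniteMeasure (ν.restrict K) := ⟨by simpa using hν⟩
  obtain ⟨C, hC⟩ := (isCompact_Icc.prod hK).exists_bound_of_continuousOn hg'
  have hKm := hK.measurableSet
  have hmem : Set.Ioo a b ∈ nhds t := isOpen_Ioo.mem_nhds ht
  have hg't : ContinuousOn (g' t) K :=
    hg'.comp (f := fun z => (t, z)) (by fun_prop) (fun z hz => ⟨Set.Ioo_subset_Icc_self ht, hz⟩)
  have hint : ∀ f : E3 → ℂ, ContinuousOn f K → Integrable f (ν.restrict K) := by
    intro f hf
    exact hf.integrableOn_of_subset_isCompact hK hKm subset_rfl hν.ne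
  refine (hasDerivAt_integral_of_dominated_loc_of_deriv_le (bound := fun _ => C) hmem ?_ ?_ ?_ ?_ ?_ ?_).2
  · filter_upwards [hmem] with s hs using (hg s hs).aestronglyMeasurable hKm
  · exact hint _ (hg t ht)
  · exact hg't.aestronglyMeasurable hKm
  · filter_upwards [ae_restrict_mem hKm] with z hz s hs
    exact hC (s, z) ⟨Set.Ioo_subset_Icc_self hs, hz⟩
  · exact integrable_const _
  · filter_upwards [ae_restrict_mem hKm] with z hz s hs using hd s hs z hz

lemma continuousOn_param {K : Set E3} (hK : IsCompact K) {ν : Measure E3} (hν : ν K < ⊤)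
    {a b : ℝ} {g : ℝ → E3 → ℂ}
    (hg : ContinuousOn (fun p : ℝ × E3 => g p.1 p.2) (Set.Icc a b ×ˢ K)) :
    ContinuousOn (fun s => ∫ z in K, g s z ∂ν) (Set.Icc a b) := by
  have : IsFiniteMeasure (ν.restrict K) := ⟨by simpa using hν⟩
  obtain ⟨C, hC⟩ := (isCompact_Icc.prod hK).exists_bound_of_continuousOn hg
  have hKm := hK.measurableSet
  refine continuousOn_of_dominated (bound := fun _ => C) ?_ ?_ (integrable_const _) ?_
  · intro t ht
    exact ContinuousOn.aestronglyMeasurable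
      (hg.comp (f := fun z => (t, z)) (by fun_prop) (fun z hz => ⟨ht, hz⟩)) hKm
  · intro t ht
    filter_upwards [ae_restrict_mem hKm] with z hz using hC (t, z) ⟨ht, hz⟩
  · filter_upwards [ae_restrict_mem hKm] with z hz
    exact hg.comp (f := fun t => (t, z)) (by fun_prop) (fun t ht => ⟨ht, hz⟩)

noncomputable def e3 (i : Fin 3) : E3 := EuclideanSpace.single i (1 : ℝ)

/-- rotation in the `i`,`j` plane -/
noncomputable def rot (i j : Fin 3) (t : ℝ) (z : E3) : E3 :=
  z + ((cos t - 1) * z i - sin t * z j) • e3 i + ((cos t - 1) * z j + sin t * z i) • e3 j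

lemma norm_rot {i j : Fin 3} (hij : i ≠ j) (t : ℝ) (z : E3) : ‖rot i j t z‖ = ‖z‖ := by
  refine (pow_left_inj₀ (norm_nonneg _) (norm_nonneg _) two_ne_zero).1 ?_
  rw [EuclideanSpace.norm_sq_eq, EuclideanSpace.norm_sq_eq, Fin.sum_univ_three, Fin.sum_univ_three]
  have h := sin_sq_add_cos_sq t
  fin_cases i <;> fin_cases j <;> simp [rot, e3] at hij ⊢
  · linear_combination (z 0 ^ 2 + z 1 ^ 2) * h
  · linear_combination (z 0 ^ 2 + z 2 ^ 2) * h
  · linear_combination (z 0 ^ 2 + z 1 ^ 2) * h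
  · linear_combination (z 1 ^ 2 + z 2 ^ 2) * h
  · linear_combination (z 0 ^ 2 + z 2 ^ 2) * h
  · linear_combination (z 1 ^ 2 + z 2 ^ 2) * h

noncomputable def rotLI {i j : Fin 3} (hij : i ≠ j) (t : ℝ) : E3 →ₗᵢ[ℝ] E3 where
  toFun := rot i j t
  map_add' x y := by
    simp only [rot, PiLp.add_apply]; module
  map_smul' c x := by
    simp only [rot, PiLp.smul_apply, smul_eq_mul, RingHom.id_apply]; module
  norm_map' := norm_rot hij t

lemma integral_rot {i j : Fin 3} (hij : i ≠ j) (t ρ : ℝ) (f : E3 → ℂ) :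
    ∫ z in Metric.sphere (0 : E3) ρ, f (rot i j t z) ∂(μH[2]) =
      ∫ z in Metric.sphere (0 : E3) ρ, f z ∂(μH[2]) := by
  let L := ((rotLI hij t).toLinearIsometryEquiv rfl)
  have hL : ∀ z, L z = rot i j t z := fun z => rfl
  have mp := (L.toIsometryEquiv).measurePreserving_hausdorffMeasure 2
  have me : MeasurableEmbedding L.toIsometryEquiv :=
    L.toIsometryEquiv.toHomeomorph.measurableEmbedding
  have := mp.setIntegral_preimage_emb me f (Metric.sphere (0 : E3) ρ)
  rw [← this]
  have hs : L.toIsometryEquiv ⁻¹' Metric.sphere (0 : E3) ρ = Metric.sphere (0 : E3) ρ := by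
    ext z
    simp
  rw [hs]
  rfl

/-- angular derivative integrates to zero -/
lemma integral_angular {ρ : ℝ} (hρ : 0 < ρ) (i j : Fin 3) {W : Set E3} (hW : IsOpen W)
    (hsub : Metric.sphere (0 : E3) ρ ⊆ W) {f : E3 → ℂ} (hf : ContDiffOn ℝ 1 f W) :
    ∫ z in Metric.sphere (0 : E3) ρ,
      ((z i : ℂ) * fderiv ℝ f z (e3 j) - (z j : ℂ) * fderiv ℝ f z (e3 i)) ∂(μH[2]) = 0 := by
  by_cases hij : i = j
  · subst hij; simp
  have hK : IsCompact (Metric.sphere (0 : E3) ρ) := isCompact_sphere _ _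
  have hr : ∀ t, ∀ z ∈ Metric.sphere (0 : E3) ρ, rot i j t z ∈ Metric.sphere (0 : E3) ρ := by
    intro t z hz
    simpa [norm_rot hij t z] using hz
  let r' : ℝ → E3 → E3 := fun t z =>
    (-sin t * z i - cos t * z j) • e3 i + (-sin t * z j + cos t * z i) • e3 j
  have hr' : ∀ t z, HasDerivAt (fun s => rot i j s z) (r' t z) t := by
    intro t z
    unfold rot
    have c := hasDerivAt_cos t
    have s := hasDerivAt_sin t
    have A := (((c.sub_const 1).mul_const (z i)).sub (s.mul_const (z j))).smul_const (e3 i)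
    have B := (((c.sub_const 1).mul_const (z j)).add (s.mul_const (z i))).smul_const (e3 j)
    have := (A.const_add z).add B
    exact this
  have hfd : ∀ z ∈ W, HasFDerivAt f (fderiv ℝ f z) z := fun z hz =>
    ((hf.contDiffAt (hW.mem_nhds hz)).differentiableAt (by norm_num)).hasFDerivAt
  have hcf : ContinuousOn (fderiv ℝ f) W := hf.continuousOn_fderiv_of_isOpen hW (by norm_num)
  have hrc : Continuous (fun p : ℝ × E3 => rot i j p.1 p.2) := by
    unfold rot; fun_prop
  have hrc' : Continuous (fun p : ℝ × E3 => r' p.1 p.2) := by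
    simp only [r']; fun_prop
  have key := hasDerivAt_param hK (sphere_finite_s11 ρ hρ) (a := -1) (b := 1)
    (g := fun t z => f (rot i j t z)) (g' := fun t z => fderiv ℝ f (rot i j t z) (r' t z))
    (fun t _ => hf.continuousOn.comp (hrc.comp (by fun_prop : Continuous fun z : E3 => (t, z))).continuousOn
      (fun z hz => hsub (hr t z hz)))
    ((hcf.comp hrc.continuousOn (fun p hp => hsub (hr p.1 p.2 hp.2))).clm_apply hrc'.continuousOn)
    (fun t _ z hz => (hfd _ (hsub (hr t z hz))).comp_hasDerivAt t (hr' t z))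
    (t := 0) (by norm_num)
  simp_rw [integral_rot hij] at key
  have h0 := key.unique (hasDerivAt_const _ _)
  rw [← h0]
  congr 1
  ext z
  simp [r', rot]
  ring


lemma integrable_angular {ρ : ℝ} (hρ : 0 < ρ) (i j : Fin 3) {W : Set E3} (hW : IsOpen W)
    (hsub : Metric.sphere (0 : E3) ρ ⊆ W) {f : E3 → ℂ} (hf : ContDiffOn ℝ 1 f W) :
    Integrable (fun z : E3 =>
      ((z i : ℂ) * fderiv ℝ f z (e3 j) - (z j : ℂ) * fderiv ℝ f z (e3 i)))
      ((μH[2]).restrict (Metric.sphere (0 : E3) ρ)) := by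
  have hcf : ContinuousOn (fderiv ℝ f) (Metric.sphere (0 : E3) ρ) :=
    (hf.continuousOn_fderiv_of_isOpen hW (by norm_num)).mono hsub
  have h1 : ∀ k, ContinuousOn (fun z : E3 => (z k : ℂ)) (Metric.sphere (0 : E3) ρ) := by
    intro k; fun_prop
  have h2 : ∀ k, ContinuousOn (fun z : E3 => fderiv ℝ f z (e3 k)) (Metric.sphere (0 : E3) ρ) :=
    fun k => hcf.clm_apply continuousOn_const
  exact (((h1 i).mul (h2 j)).sub ((h1 j).mul (h2 i))).integrableOn_of_subset_isCompact
    (isCompact_sphere _ _) (isCompact_sphere _ _).measurableSet subset_rfl (sphere_finite_s11 ρ hρ).ne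

lemma hasFDerivAt_coord (j : Fin 3) (z : E3) :
    HasFDerivAt (fun z : E3 => (z j : ℂ))
      (Complex.ofRealCLM.comp (EuclideanSpace.proj j : E3 →L[ℝ] ℝ)) z :=
  (Complex.ofRealCLM.comp (EuclideanSpace.proj j : E3 →L[ℝ] ℝ)).hasFDerivAt

lemma fderiv_expand (T : E3 →L[ℝ] ℂ) (z : E3) :
    T z = z 0 * T (e3 0) + z 1 * T (e3 1) + z 2 * T (e3 2) := by
  have : z = z 0 • e3 0 + z 1 • e3 1 + z 2 • e3 2 := by
    ext k; fin_cases k <;> simp [e3]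
  conv_lhs => rw [this]
  simp only [map_add, map_smul, Complex.real_smul]

lemma flux_step {ρ : ℝ} (hρ : 0 < ρ) {W : Set E3} (hW : IsOpen W)
    (hsub : Metric.sphere (0 : E3) ρ ⊆ W) {V : Fin 3 → E3 → ℂ}
    (hV : ∀ i, ContDiffOn ℝ 1 (V i) W)
    (hdiv : ∀ z ∈ Metric.sphere (0 : E3) ρ, ∑ i, fderiv ℝ (V i) z (e3 i) = 0) :
    ∫ z in Metric.sphere (0 : E3) ρ,
      (2 * ∑ i, (z i : ℂ) * V i z + ∑ i, (z i : ℂ) * fderiv ℝ (V i) z z) ∂(μH[2]) = 0 := by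
  have hcd : ∀ i j, ContDiffOn ℝ 1 (fun z : E3 => (z j : ℂ) * V i z) W := by
    intro i j
    refine ContDiffOn.mul ?_ (hV i)
    exact (Complex.ofRealCLM.comp (EuclideanSpace.proj j : E3 →L[ℝ] ℝ)).contDiff.contDiffOn
  have h0 := fun i j => integral_angular hρ j i hW hsub (hcd i j)
  have h1 := fun i j => integrable_angular hρ j i hW hsub (hcd i j)
  have hsum : ∫ z in Metric.sphere (0 : E3) ρ, (-∑ i, ∑ j,
      ((z j : ℂ) * fderiv ℝ (fun z : E3 => (z j : ℂ) * V i z) z (e3 i)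
        - (z i : ℂ) * fderiv ℝ (fun z : E3 => (z j : ℂ) * V i z) z (e3 j))) ∂(μH[2]) = 0 := by
    rw [integral_neg, integral_finsetSum _ (fun i _ => integrable_finsetSum _ (fun j _ => h1 i j))]
    simp_rw [integral_finsetSum _ (fun j _ => h1 _ j), h0]
    simp
  rw [← hsum]
  refine setIntegral_congr_fun (isCompact_sphere _ _).measurableSet ?_
  intro z hz
  have hfd : ∀ i j, fderiv ℝ (fun z : E3 => (z j : ℂ) * V i z) z = _ := fun i j =>
    ((hasFDerivAt_coord j z).mul (((hV i).contDiffAt (hW.mem_nhds (hsub hz))).differentiableAt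
      (by norm_num)).hasFDerivAt).fderiv
  have hd := hdiv z hz
  simp only [hfd]
  simp only [fderiv_expand _ z, Fin.sum_univ_three] at hd ⊢
  simp [e3] at hd ⊢
  linear_combination (((z 0 : ℂ) ^ 2 + (z 1 : ℂ) ^ 2 + (z 2 : ℂ) ^ 2)) * hd

lemma flux_zero {ρ : ℝ} (hρ : 0 < ρ) {W : Set E3} (hW : IsOpen W)
    (hsub : Metric.closedBall (0 : E3) ρ ⊆ W) {V : Fin 3 → E3 → ℂ}
    (hV : ∀ i, ContDiffOn ℝ 1 (V i) W)
    (hdiv : ∀ z ∈ Metric.ball (0 : E3) ρ, ∑ i, fderiv ℝ (V i) z (e3 i) = 0) :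
    ∫ z in Metric.sphere (0 : E3) ρ, (∑ i, (z i : ℂ) * V i z) ∂(μH[2]) = 0 := by
  have hK : IsCompact (Metric.sphere (0 : E3) ρ) := isCompact_sphere _ _
  have hmem : ∀ t ∈ Set.Icc (0 : ℝ) 1, ∀ z ∈ Metric.sphere (0 : E3) ρ, t • z ∈ W := by
    intro t ht z hz
    apply hsub
    have : ‖z‖ = ρ := by simpa using hz
    simp only [mem_closedBall_zero_iff, norm_smul, this, Real.norm_eq_abs, abs_of_nonneg ht.1]
    nlinarith [ht.2]
  have hcf : ∀ i, ContinuousOn (fderiv ℝ (V i)) W :=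
    fun i => (hV i).continuousOn_fderiv_of_isOpen hW (by norm_num)
  have hdf : ∀ i, ∀ z ∈ W, HasFDerivAt (V i) (fderiv ℝ (V i) z) z := fun i z hz =>
    (((hV i).contDiffAt (hW.mem_nhds hz)).differentiableAt (by norm_num)).hasFDerivAt
  have hsm : Continuous (fun p : ℝ × E3 => p.1 • p.2) := by fun_prop
  have hmaps : Set.MapsTo (fun p : ℝ × E3 => p.1 • p.2)
      (Set.Icc 0 1 ×ˢ Metric.sphere (0 : E3) ρ) W := fun p hp => hmem p.1 hp.1 p.2 hp.2
  have hgc : ContinuousOn (fun p : ℝ × E3 => ∑ i, (p.2 i : ℂ) * V i (p.1 • p.2))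
      (Set.Icc 0 1 ×ˢ Metric.sphere (0 : E3) ρ) := by
    refine continuousOn_finsetSum _ fun i _ => ContinuousOn.mul (by fun_prop) ?_
    exact (hV i).continuousOn.comp hsm.continuousOn hmaps
  have hgc' : ContinuousOn (fun p : ℝ × E3 => ∑ i, (p.2 i : ℂ) * fderiv ℝ (V i) (p.1 • p.2) p.2)
      (Set.Icc 0 1 ×ˢ Metric.sphere (0 : E3) ρ) := by
    refine continuousOn_finsetSum _ fun i _ => ContinuousOn.mul (by fun_prop) ?_
    exact ((hcf i).comp hsm.continuousOn hmaps).clm_apply (by fun_prop)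
  let G : ℝ → ℂ := fun t => ∫ z in Metric.sphere (0 : E3) ρ, (∑ i, (z i : ℂ) * V i (t • z)) ∂(μH[2])
  let G' : ℝ → ℂ := fun t =>
    ∫ z in Metric.sphere (0 : E3) ρ, (∑ i, (z i : ℂ) * fderiv ℝ (V i) (t • z) z) ∂(μH[2])
  have hG : ContinuousOn G (Set.Icc 0 1) :=
    continuousOn_param hK (sphere_finite_s11 ρ hρ)
      (g := fun t z => ∑ i, (z i : ℂ) * V i (t • z)) hgc
  have hslice : ∀ (F : ℝ × E3 → ℂ), ContinuousOn F (Set.Icc 0 1 ×ˢ Metric.sphere (0 : E3) ρ) →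
      ∀ t ∈ Set.Ioo (0 : ℝ) 1, ContinuousOn (fun z => F (t, z)) (Metric.sphere (0 : E3) ρ) :=
    fun F hF t ht => hF.comp (f := fun z => (t, z)) (by fun_prop)
      (fun z hz => ⟨Set.Ioo_subset_Icc_self ht, hz⟩)
  have hGd : ∀ t ∈ Set.Ioo (0 : ℝ) 1, HasDerivAt G (G' t) t := by
    intro t ht
    refine hasDerivAt_param hK (sphere_finite_s11 ρ hρ)
      (g := fun t z => ∑ i, (z i : ℂ) * V i (t • z))
      (g' := fun t z => ∑ i, (z i : ℂ) * fderiv ℝ (V i) (t • z) z)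
      (hslice _ hgc) hgc' ?_ ht
    intro s hs z hz
    refine HasDerivAt.fun_sum fun i _ => HasDerivAt.const_mul _ ?_
    have h1 : HasDerivAt (fun s : ℝ => s • z) z s := by
      simpa using (hasDerivAt_id s).smul_const z
    exact (hdf i _ (hmem s (Set.Ioo_subset_Icc_self hs) z hz)).comp_hasDerivAt s h1
  have hrel : ∀ t ∈ Set.Ioo (0 : ℝ) 1, 2 * G t + t * G' t = 0 := by
    intro t ht
    have hWt : IsOpen ((fun z : E3 => t • z) ⁻¹' W) := hW.preimage (by fun_prop)
    have htI := Set.Ioo_subset_Icc_self ht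
    have hfdt : ∀ i, ∀ z ∈ Metric.sphere (0 : E3) ρ,
        fderiv ℝ (fun z => V i (t • z)) z = t • fderiv ℝ (V i) (t • z) := by
      intro i z hz
      have h1 : HasFDerivAt (fun z : E3 => t • z) (t • ContinuousLinearMap.id ℝ E3) z :=
        (hasFDerivAt_id z).const_smul t
      refine ((hdf i _ (hmem t htI z hz)).comp z h1).fderiv.trans ?_
      ext v; simp
    have := flux_step hρ hWt (fun z hz => hmem t htI z hz) (V := fun i z => V i (t • z))
      (fun i => (hV i).comp (contDiff_const_smul t).contDiffOn (fun z hz => hz)) (by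
        intro z hz
        simp only [hfdt _ z hz]
        have hb : t • z ∈ Metric.ball (0 : E3) ρ := by
          have : ‖z‖ = ρ := by simpa using hz
          simp only [mem_ball_zero_iff, norm_smul, this, Real.norm_eq_abs, abs_of_pos ht.1]
          nlinarith [ht.2]
        simp only [smul_apply, ← Finset.smul_sum, hdiv _ hb, smul_zero])
    have hint : ∀ f : E3 → ℂ, ContinuousOn f (Metric.sphere (0 : E3) ρ) →
        Integrable f ((μH[2]).restrict (Metric.sphere (0 : E3) ρ)) := fun f hf =>
      hf.integrableOn_of_subset_isCompact hK hK.measurableSet subset_rfl (sphere_finite_s11 ρ hρ).ne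
    rw [← this]
    simp only [G, G']
    rw [← integral_const_mul, ← integral_const_mul, ← integral_add]
    · refine setIntegral_congr_fun hK.measurableSet ?_
      intro z hz
      simp only [hfdt _ z hz, smul_apply, Complex.real_smul, Finset.mul_sum]
      congr 1
      exact Finset.sum_congr rfl fun i _ => by ring
    · exact (hint _ (hslice _ hgc t ht)).const_mul _
    · exact (hint _ (hslice _ hgc' t ht)).const_mul _
  let F : ℝ → ℂ := fun t => (t : ℂ) ^ 2 * G t
  have hF : ContinuousOn F (Set.Icc 0 1) := ContinuousOn.mul (by fun_prop) hG
  have hF' : ∀ t ∈ Set.Ioo (0 : ℝ) 1, HasDerivAt F 0 t := by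
    intro t ht
    have h1 : HasDerivAt (fun t : ℝ => (t : ℂ) ^ 2) (2 * t) t := by
      have h0 : HasDerivAt (fun t : ℝ => (t : ℂ)) 1 t := Complex.ofRealCLM.hasDerivAt (x := t)
      simpa using h0.fun_pow 2
    have := h1.fun_mul (hGd t ht)
    refine this.congr_deriv ?_
    linear_combination (t : ℂ) * hrel t ht
  have hconst : F 1 = F 0 := by
    have := intervalIntegral.integral_eq_sub_of_hasDerivAt_of_le (f' := fun _ => (0 : ℂ))
      zero_le_one hF hF' (by simp)
    simp only [intervalIntegral.integral_zero] at this
    exact sub_eq_zero.1 this.symm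
  have : G 1 = 0 := by
    simpa [F] using hconst
  simpa [G] using this

noncomputable def hh (lam q : ℝ) : ℂ :=
  Complex.exp (Complex.I * (lam : ℂ) * (√q : ℝ)) * (4 * (π : ℂ) * (√q : ℝ))⁻¹

noncomputable def hh1 (lam q : ℝ) : ℂ :=
  Complex.exp (Complex.I * (lam : ℂ) * (√q : ℝ)) * (Complex.I * (lam : ℂ) * (√q : ℝ) - 1) *
    (8 * (π : ℂ) * (√q : ℝ) ^ 3)⁻¹

lemma hh_deriv (lam : ℝ) {q : ℝ} (hq : 0 < q) : HasDerivAt (hh lam) (hh1 lam q) q := by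
  have hs0 : (0 : ℝ) < √q := Real.sqrt_pos.2 hq
  have hsc : ((√q : ℝ) : ℂ) ≠ 0 := by exact_mod_cast hs0.ne'
  have hpi : (π : ℂ) ≠ 0 := by exact_mod_cast Real.pi_ne_zero
  have hs : HasDerivAt (fun q : ℝ => ((√q : ℝ) : ℂ)) ((1 / (2 * √q) : ℝ) : ℂ) q :=
    (Real.hasDerivAt_sqrt hq.ne').ofReal_comp
  have he := (hs.const_mul (Complex.I * (lam : ℂ))).cexp
  have hi := (hs.const_mul (4 * (π : ℂ))).fun_inv (mul_ne_zero (mul_ne_zero (by norm_num) hpi) hsc)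
  refine (he.fun_mul hi).congr_deriv ?_
  unfold hh1
  push_cast
  field_simp
  ring

lemma hh1_deriv (lam : ℝ) {q : ℝ} (hq : 0 < q) :
    HasDerivAt (hh1 lam) ((-(lam : ℂ) ^ 2 * hh lam q - 6 * hh1 lam q) / (4 * (q : ℂ))) q := by
  have hs0 : (0 : ℝ) < √q := Real.sqrt_pos.2 hq
  have hsc : ((√q : ℝ) : ℂ) ≠ 0 := by exact_mod_cast hs0.ne'
  have hpi : (π : ℂ) ≠ 0 := by exact_mod_cast Real.pi_ne_zero
  have hs : HasDerivAt (fun q : ℝ => ((√q : ℝ) : ℂ)) ((1 / (2 * √q) : ℝ) : ℂ) q :=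
    (Real.hasDerivAt_sqrt hq.ne').ofReal_comp
  have hq2 : (q : ℂ) = ((√q : ℝ) : ℂ) ^ 2 := by
    rw [← Complex.ofReal_pow, Real.sq_sqrt hq.le]
  have he := (hs.const_mul (Complex.I * (lam : ℂ))).cexp
  have hm := (hs.const_mul (Complex.I * (lam : ℂ))).sub_const 1
  have hi := ((hs.fun_pow 3).const_mul (8 * (π : ℂ))).fun_inv
    (mul_ne_zero (mul_ne_zero (by norm_num) hpi) (pow_ne_zero 3 hsc))
  refine ((he.fun_mul hm).fun_mul hi).congr_deriv ?_
  unfold hh hh1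
  rw [hq2]
  push_cast
  generalize ((√q : ℝ) : ℂ) = s at *
  generalize Complex.exp (Complex.I * (lam : ℂ) * s) = e at *
  have hI : Complex.I ^ 2 = -1 := Complex.I_sq
  field_simp
  ring_nf
  simp only [hI]
  ring

lemma contDiffOn_sq (x : E3) : ContDiffOn ℝ 1 (fun z : E3 => ((√(‖z - x‖ ^ 2) : ℝ) : ℂ)) {x}ᶜ := by
  refine Complex.ofRealCLM.contDiff.comp_contDiffOn (ContDiffOn.sqrt ?_ ?_)
  · exact ((contDiff_id.sub contDiff_const).norm_sq ℝ).contDiffOn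
  · intro z hz
    have : z - x ≠ 0 := sub_ne_zero.2 hz
    positivity

lemma sq_ne {x z : E3} (hz : z ∈ ({x}ᶜ : Set E3)) : ((√(‖z - x‖ ^ 2) : ℝ) : ℂ) ≠ 0 := by
  have : z - x ≠ 0 := sub_ne_zero.2 hz
  have h : 0 < √(‖z - x‖ ^ 2) := by positivity
  exact_mod_cast h.ne'

lemma contDiffOn_hh (lam : ℝ) (x : E3) :
    ContDiffOn ℝ 1 (fun z : E3 => hh lam (‖z - x‖ ^ 2)) {x}ᶜ := by
  have hpi : (π : ℂ) ≠ 0 := by exact_mod_cast Real.pi_ne_zero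
  exact ((contDiffOn_const.mul (contDiffOn_sq x)).cexp).mul
    ((contDiffOn_const.mul (contDiffOn_sq x)).inv
      fun z hz => mul_ne_zero (mul_ne_zero (by norm_num) hpi) (sq_ne hz))

lemma contDiffOn_hh1 (lam : ℝ) (x : E3) :
    ContDiffOn ℝ 1 (fun z : E3 => hh1 lam (‖z - x‖ ^ 2)) {x}ᶜ := by
  have hpi : (π : ℂ) ≠ 0 := by exact_mod_cast Real.pi_ne_zero
  exact (((contDiffOn_const.mul (contDiffOn_sq x)).cexp).mul
    ((contDiffOn_const.mul (contDiffOn_sq x)).sub contDiffOn_const)).mul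
    ((contDiffOn_const.mul ((contDiffOn_sq x).pow 3)).inv
      fun z hz => mul_ne_zero (mul_ne_zero (by norm_num) hpi) (pow_ne_zero 3 (sq_ne hz)))

lemma hasFDerivAt_q (x z : E3) :
    HasFDerivAt (fun z : E3 => ‖z - x‖ ^ 2) (2 • innerSL ℝ (z - x)) z := by
  have := (hasStrictFDerivAt_norm_sq (z - x)).hasFDerivAt.comp z ((hasFDerivAt_id z).sub_const x)
  exact this

lemma hh_comp_deriv (lam : ℝ) {x z : E3} (hz : z ≠ x) :
    HasFDerivAt (fun z : E3 => hh lam (‖z - x‖ ^ 2))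
      ((2 • innerSL ℝ (z - x) : E3 →L[ℝ] ℝ).smulRight (hh1 lam (‖z - x‖ ^ 2))) z := by
  have hq : 0 < ‖z - x‖ ^ 2 := by
    have : z - x ≠ 0 := sub_ne_zero.2 hz
    positivity
  refine ((hh_deriv lam hq).hasFDerivAt.comp z (hasFDerivAt_q x z)).congr_fderiv ?_
  ext v; simp; ring

lemma hh1_comp_deriv (lam : ℝ) {x z : E3} (hz : z ≠ x) :
    HasFDerivAt (fun z : E3 => hh1 lam (‖z - x‖ ^ 2))
      ((2 • innerSL ℝ (z - x) : E3 →L[ℝ] ℝ).smulRight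
        ((-(lam : ℂ) ^ 2 * hh lam (‖z - x‖ ^ 2) - 6 * hh1 lam (‖z - x‖ ^ 2)) /
          (4 * ((‖z - x‖ ^ 2 : ℝ) : ℂ)))) z := by
  have hq : 0 < ‖z - x‖ ^ 2 := by
    have : z - x ≠ 0 := sub_ne_zero.2 hz
    positivity
  refine ((hh1_deriv lam hq).hasFDerivAt.comp z (hasFDerivAt_q x z)).congr_fderiv ?_
  ext v; simp; ring

/-- The single-layer potential with density `∂ₙu` vanishes outside the
ball: if `Δu + λ²u = 0` in the open ball `Ω ⊆ ℝ³` of radius `ρ` and `u = 0` on the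
boundary sphere, then for every `x` with `|x| > ρ`,
`∫_{|z|=ρ} (e^{iλ|x-z|}/(4π|x-z|)) ∂ₙu(z) dσ(z) = 0`,
with `∂ₙu(z) = (z/ρ)·∇u(z)` the outward normal derivative. -/
theorem dirichlet_eigenfunction_layer_potential_vanishes_outside_3d
    (ρ lam : ℝ) (hρ : 0 < ρ) (hlam : 0 < lam)
    (u : EuclideanSpace ℝ (Fin 3) → ℝ)
    (U : Set (EuclideanSpace ℝ (Fin 3))) (hU : IsOpen U)
    (hUc : Metric.closedBall (0 : EuclideanSpace ℝ (Fin 3)) ρ ⊆ U)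
    (hu : ContDiffOn ℝ 2 u U)
    (heq : ∀ x ∈ Metric.ball (0 : EuclideanSpace ℝ (Fin 3)) ρ,
      (∑ i : Fin 3,
          fderiv ℝ (fun w => fderiv ℝ u w (EuclideanSpace.single i (1 : ℝ))) x
            (EuclideanSpace.single i (1 : ℝ)))
        + lam ^ 2 * u x = 0)
    (hbd : ∀ z : EuclideanSpace ℝ (Fin 3), ‖z‖ = ρ → u z = 0)
    (x : EuclideanSpace ℝ (Fin 3)) (hx : ρ < ‖x‖) :
    (∫ z in Metric.sphere (0 : EuclideanSpace ℝ (Fin 3)) ρ,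
        (Complex.exp (Complex.I * (lam : ℂ) * (‖x - z‖ : ℝ)) /
            (4 * (π : ℂ) * (‖x - z‖ : ℝ))) *
          ((fderiv ℝ u z (ρ⁻¹ • z) : ℝ) : ℂ) ∂(μH[2])) = 0 := by
  let W : Set E3 := U ∩ {x}ᶜ
  have hW : IsOpen W := hU.inter isOpen_compl_singleton
  have hsub : Metric.closedBall (0 : E3) ρ ⊆ W := by
    intro z hz
    refine ⟨hUc hz, ?_⟩
    rintro rfl
    simp at hz
    linarith
  have hDu : ∀ i, ContDiffOn ℝ 1 (fun w => fderiv ℝ u w (e3 i)) U := fun i =>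
    (hu.fderiv_of_isOpen hU (m := 1) (by norm_num)).clm_apply contDiffOn_const
  let V : Fin 3 → E3 → ℂ := fun i z =>
    hh lam (‖z - x‖ ^ 2) * ((fderiv ℝ u z (e3 i) : ℝ) : ℂ) -
      (u z : ℂ) * ((2 * ((z i : ℂ) - (x i : ℂ))) * hh1 lam (‖z - x‖ ^ 2))
  have hV : ∀ i, ContDiffOn ℝ 1 (V i) W := by
    intro i
    have c1 := (contDiffOn_hh lam x).mono (Set.inter_subset_right (s := U))
    have c2 := (contDiffOn_hh1 lam x).mono (Set.inter_subset_right (s := U))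
    have c3 : ContDiffOn ℝ 1 (fun w => ((fderiv ℝ u w (e3 i) : ℝ) : ℂ)) W :=
      Complex.ofRealCLM.contDiff.comp_contDiffOn ((hDu i).mono Set.inter_subset_left)
    have c4 : ContDiffOn ℝ 1 (fun w => (u w : ℂ)) W :=
      Complex.ofRealCLM.contDiff.comp_contDiffOn
        ((hu.of_le (by norm_num)).mono Set.inter_subset_left)
    have c5 : ContDiffOn ℝ 1 (fun z : E3 => (z i : ℂ)) W :=
      (Complex.ofRealCLM.comp (EuclideanSpace.proj i : E3 →L[ℝ] ℝ)).contDiff.contDiffOn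
    exact (c1.mul c3).sub (c4.mul ((contDiffOn_const.mul (c5.sub contDiffOn_const)).mul c2))
  have hdiv : ∀ z ∈ Metric.ball (0 : E3) ρ, ∑ i, fderiv ℝ (V i) z (e3 i) = 0 := by
    intro z hz
    have hzW := hsub (Metric.ball_subset_closedBall hz)
    have hzU : z ∈ U := hzW.1
    have hzx : z ≠ x := hzW.2
    have d1 := hh_comp_deriv lam hzx
    have d2 := hh1_comp_deriv lam hzx
    have d3 : ∀ i, HasFDerivAt (fun w => ((fderiv ℝ u w (e3 i) : ℝ) : ℂ))
        (Complex.ofRealCLM.comp (fderiv ℝ (fun w => fderiv ℝ u w (e3 i)) z)) z := fun i =>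
      Complex.ofRealCLM.hasFDerivAt.comp z
        (((hDu i).contDiffAt (hU.mem_nhds hzU)).differentiableAt (by norm_num)).hasFDerivAt
    have d4 : HasFDerivAt (fun w => (u w : ℂ)) (Complex.ofRealCLM.comp (fderiv ℝ u z)) z :=
      Complex.ofRealCLM.hasFDerivAt.comp z
        ((hu.contDiffAt (hU.mem_nhds hzU)).differentiableAt (by norm_num)).hasFDerivAt
    have hfd : ∀ i, fderiv ℝ (V i) z (e3 i) =
        hh lam (‖z - x‖ ^ 2) * ((fderiv ℝ (fun w => fderiv ℝ u w (e3 i)) z (e3 i) : ℝ) : ℂ) -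
        (u z : ℂ) * (2 * hh1 lam (‖z - x‖ ^ 2) + 4 * ((z i : ℂ) - (x i : ℂ)) ^ 2 *
          ((-(lam : ℂ) ^ 2 * hh lam (‖z - x‖ ^ 2) - 6 * hh1 lam (‖z - x‖ ^ 2)) /
          (4 * ((‖z - x‖ ^ 2 : ℝ) : ℂ)))) := by
      intro i
      have d5 := (((hasFDerivAt_coord i z).sub_const (x i : ℂ)).const_mul 2).fun_mul d2
      have := ((d1.fun_mul (d3 i)).fun_sub (d4.fun_mul d5)).fderiv
      change fderiv ℝ (V i) z = _ at this
      rw [this]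
      have hcoord : (EuclideanSpace.proj i : E3 →L[ℝ] ℝ) (e3 i) = 1 := by simp [e3]
      have hinn : innerSL ℝ (z - x) (e3 i) = z i - x i := by
        simp [e3, EuclideanSpace.inner_single_right]
      simp only [sub_apply, add_apply, smul_apply, smul_eq_mul, ContinuousLinearMap.comp_apply,
        ContinuousLinearMap.smulRight_apply, hinn, Complex.ofRealCLM_apply, Complex.real_smul,
        hcoord]
      push_cast
      ring
    simp only [hfd]
    have hE := congrArg (fun r : ℝ => (r : ℂ)) (heq z hz)
    have hq : ((‖z - x‖ ^ 2 : ℝ) : ℂ) =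
        ((z 0 : ℂ) - x 0) ^ 2 + ((z 1 : ℂ) - x 1) ^ 2 + ((z 2 : ℂ) - x 2) ^ 2 := by
      rw [EuclideanSpace.norm_sq_eq, Fin.sum_univ_three]
      simp
    have hq0 : ((‖z - x‖ ^ 2 : ℝ) : ℂ) ≠ 0 := by
      have : z - x ≠ 0 := sub_ne_zero.2 hzx
      have h : 0 < ‖z - x‖ ^ 2 := by positivity
      exact_mod_cast h.ne'
    have hcanc : (4 * ((‖z - x‖ ^ 2 : ℝ) : ℂ)) *
        ((-(lam : ℂ) ^ 2 * hh lam (‖z - x‖ ^ 2) - 6 * hh1 lam (‖z - x‖ ^ 2)) /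
          (4 * ((‖z - x‖ ^ 2 : ℝ) : ℂ))) =
        -(lam : ℂ) ^ 2 * hh lam (‖z - x‖ ^ 2) - 6 * hh1 lam (‖z - x‖ ^ 2) :=
      mul_div_cancel₀ _ (mul_ne_zero (by norm_num) hq0)
    generalize (-(lam : ℂ) ^ 2 * hh lam (‖z - x‖ ^ 2) - 6 * hh1 lam (‖z - x‖ ^ 2)) /
          (4 * ((‖z - x‖ ^ 2 : ℝ) : ℂ)) = H at *
    rw [hq] at hcanc
    simp only [Fin.sum_univ_three] at hE ⊢
    push_cast at hE
    change ((fderiv ℝ (fun w => fderiv ℝ u w (e3 0)) z (e3 0) : ℝ) : ℂ) +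
      ((fderiv ℝ (fun w => fderiv ℝ u w (e3 1)) z (e3 1) : ℝ) : ℂ) +
      ((fderiv ℝ (fun w => fderiv ℝ u w (e3 2)) z (e3 2) : ℝ) : ℂ) + (lam : ℂ) ^ 2 * (u z : ℂ) = 0
      at hE
    linear_combination hh lam (‖z - x‖ ^ 2) * hE - (u z : ℂ) * hcanc
  have hflux := flux_zero hρ hW hsub hV hdiv
  have : ∫ z in Metric.sphere (0 : E3) ρ, (ρ⁻¹ : ℂ) * (∑ i, (z i : ℂ) * V i z) ∂(μH[2]) = 0 := by
    rw [integral_const_mul, hflux, mul_zero]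
  rw [← this]
  refine setIntegral_congr_fun (isCompact_sphere _ _).measurableSet ?_
  intro z hz
  have hz' : ‖z‖ = ρ := by simpa using hz
  have hexp := fderiv_expand (Complex.ofRealCLM.comp (fderiv ℝ u z)) z
  simp only [ContinuousLinearMap.comp_apply, Complex.ofRealCLM_apply] at hexp
  simp only [V, hbd z hz', hh, Real.sqrt_sq (norm_nonneg _), norm_sub_rev z x, Fin.sum_univ_three,
    map_smul, smul_eq_mul, Complex.ofReal_mul, hexp, Complex.ofReal_inv, Complex.ofReal_zero,
    div_eq_mul_inv]
  ring
end
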